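/- arXiv:2503.07895 — 2 statements merged into one kernel-verified Lean document; each statement's English description precedes it below -/
import Mathlib

section
/- Let P and Q be coprime polynomials over ℂ with deg Q ≥ 1, let S ⊆ ℂ be the (finite, nonempty) set of roots of Q, let Ω = {z ∈ ℂ : Q(z) ≠ 0}, and let f : Ω → ℂ be f(z) = P(z)/Q(z). Define the limit set L ⊆ ℂ as the set of points z ∈ ℂ such that for every ε > 0 there are infinitely many n ∈ ℕ for which the n-th derivative f⁽ⁿ⁾ has a zero w ∈ Ω with |w − z| < ε. Then L = { z ∈ ℂ : there exist distinct p, q ∈ S with |z − p| = |z − q| = dist(z, S) }; that is, the zeros of the iterated derivatives of f accumulate in ℂ exactly on the edges and vertices of the Voronoi diagram of the set of poles of f. -/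
open Complex Metric Filter Set Topology

theorem Complex.norm_le_of_re_le_of_apply_eq_zero {f : ℂ → ℂ} {c z : ℂ} {M ρ R : ℝ} (hM : 0 < M)
    (hρ : ρ < R) (hf : DifferentiableOn ℂ f (ball c R)) (hfM : ∀ w ∈ ball c R, (f w).re ≤ M)
    (hf0 : f c = 0) (hz : z ∈ ball c ρ) : ‖f z‖ ≤ 2 * M * ρ / (R - ρ) := by
  have hzρ : ‖z - c‖ < ρ := mem_ball_iff_norm.mp hz
  have hmaps : MapsTo (fun w ↦ w + c) (ball 0 R) (ball c R) := fun w hw ↦ by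
    simpa [dist_eq_norm] using hw
  have hpos : 0 < ρ := (norm_nonneg _).trans_lt hzρ
  have h := borelCaratheodory_zero (f := fun w ↦ f (w + c)) (z := z - c) hM
    (hf.comp (by fun_prop) hmaps) (fun w hw ↦ hfM _ (hmaps hw)) (hpos.trans hρ)
    (by simpa using hzρ.trans hρ) (by simpa using hf0)
  simp only [sub_add_cancel] at h
  refine h.trans ?_
  have : 0 < R - ρ := sub_pos.mpr hρ
  gcongr

theorem Complex.tendsto_zero_of_bounded_of_tendsto_zero_near {ψ : ℕ → ℂ → ℂ} {c z : ℂ}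
    {M r R : ℝ} {e : ℕ → ℝ} (hr : 0 < r)
    (hd : ∀ᶠ n in atTop, DifferentiableOn ℂ (ψ n) (ball c R))
    (hM : ∀ᶠ n in atTop, ∀ w ∈ ball c R, ‖ψ n w‖ ≤ M)
    (he : Tendsto e atTop (𝓝 0))
    (hle : ∀ᶠ n in atTop, ∀ w ∈ ball c r, ‖ψ n w‖ ≤ e n) (hz : z ∈ ball c R) :
    Tendsto (fun n ↦ ψ n z) atTop (𝓝 0) := by
  obtain ⟨ρ, hzρ, hρR⟩ := exists_between (mem_ball_iff_norm.mp hz)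
  have hρ : 0 < ρ := (norm_nonneg _).trans_lt hzρ
  have hcauchy : ∀ (n k : ℕ) (s B : ℝ), 0 < s → s < R → DifferentiableOn ℂ (ψ n) (ball c R) →
      (∀ w ∈ sphere c s, ‖ψ n w‖ ≤ B) →
      ‖((k.factorial : ℂ))⁻¹ * iteratedDeriv k (ψ n) c * (z - c) ^ k‖ ≤ B * (‖z - c‖ / s) ^ k := by
    intro n k s B hs hsR hdn hB
    have h := norm_iteratedDeriv_le_of_forall_mem_sphere_norm_le k hs
      (hdn.diffContOnCl_ball (closedBall_subset_ball hsR)) hB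
    have hk : (0 : ℝ) < k.factorial := by exact_mod_cast k.factorial_pos
    rw [norm_mul, norm_mul, norm_inv, norm_pow, Complex.norm_natCast]
    calc _ ≤ (k.factorial : ℝ)⁻¹ * (k.factorial * B / s ^ k) * ‖z - c‖ ^ k := by gcongr
      _ = _ := by rw [div_pow]; field_simp
  have hlim := tendsto_tsum_of_dominated_convergence (𝓕 := atTop)
    (f := fun n k ↦ ((k.factorial : ℂ))⁻¹ * iteratedDeriv k (ψ n) c * (z - c) ^ k)
    (g := fun _ ↦ 0) (bound := fun k ↦ M * (‖z - c‖ / ρ) ^ k)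
    ((summable_geometric_of_lt_one (by positivity) ((div_lt_one hρ).mpr hzρ)).mul_left M) ?_ ?_
  · rw [tsum_zero] at hlim
    refine hlim.congr' ?_
    filter_upwards [hd] with n hdn using taylorSeries_eq_on_ball' hz hdn
  · intro k
    have hs : 0 < min r ρ / 2 := by positivity
    refine squeeze_zero_norm' (a := fun n ↦ e n * (‖z - c‖ / (min r ρ / 2)) ^ k) ?_
      (by simpa using he.mul_const _)
    filter_upwards [hd, hle] with n hdn hn
    refine hcauchy n k _ _ hs ?_ hdn fun w hw ↦ hn w ?_
    · linarith [min_le_right r ρ]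
    · rw [mem_ball, mem_sphere.mp hw]; linarith [min_le_left r ρ]
  · filter_upwards [hd, hM] with n hdn hn k
    refine hcauchy n k ρ M hρ hρR hdn fun w hw ↦ hn w ?_
    rw [mem_ball, mem_sphere.mp hw]; exact hρR

theorem Complex.exists_log_quotient_on_ball {g : ℂ → ℂ} {c : ℂ} {R : ℝ} (hR : 0 < R)
    (hg : DifferentiableOn ℂ g (ball c R)) (h0 : ∀ w ∈ ball c R, g w ≠ 0) :
    ∃ l : ℂ → ℂ, DifferentiableOn ℂ l (ball c R) ∧ l c = 0 ∧
      ∀ w ∈ ball c R, ‖g w‖ = ‖g c‖ * Real.exp (l w).re := by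
  obtain ⟨l, hl0, hl⟩ := (((hg.deriv isOpen_ball).div hg h0).isExactOn_ball).with_val_at c 0
  have hld : DifferentiableOn ℂ l (ball c R) := fun w hw ↦
    (hl w hw).differentiableAt.differentiableWithinAt
  refine ⟨l, hld, hl0, fun w hw ↦ ?_⟩
  have hconst : g w * exp (-l w) = g c * exp (-l c) := by
    refine isOpen_ball.is_const_of_deriv_eq_zero (f := fun w ↦ g w * exp (-l w))
      (convex_ball c R).isPreconnected (by fun_prop) (fun x hx ↦ ?_) hw (mem_ball_self hR)
    have hgx := (hg.differentiableAt (isOpen_ball.mem_nhds hx)).hasDerivAt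
    have := (hgx.mul (hl x hx).neg.cexp).deriv
    refine this.trans ?_
    have := h0 x hx
    simp only [Pi.div_apply, Pi.neg_apply, Pi.zero_apply]
    field_simp
    ring
  have : g w = g c * exp (l w) := by
    rw [hl0, neg_zero, exp_zero, mul_one, exp_neg] at hconst
    rw [← hconst, inv_mul_cancel_right₀ (exp_ne_zero _)]
  rw [this, norm_mul, norm_exp]

theorem Complex.eventually_norm_lt_pow_of_ne_zero {G : ℕ → ℂ → ℂ} {c z : ℂ} {r R K a b η : ℝ}
    (hr : 0 < r) (hrR : r ≤ R) (hz : z ∈ ball c R) (ha : 0 < a) (hη : 1 < η)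
    (hd : ∀ᶠ n in atTop, DifferentiableOn ℂ (G n) (ball c R))
    (h0 : ∀ᶠ n in atTop, ∀ w ∈ ball c R, G n w ≠ 0)
    (hGK : ∀ᶠ n in atTop, ∀ w ∈ ball c R, ‖G n w‖ ≤ K ^ n)
    (hab : ∀ᶠ n in atTop, ∀ w ∈ ball c r, a ≤ ‖G n w‖ ∧ ‖G n w‖ ≤ b) :
    ∀ᶠ n in atTop, ‖G n z‖ < η ^ n := by
  have hR : 0 < R := hr.trans_le hrR
  have hlog : ∀ᶠ n in atTop, ∃ l : ℂ → ℂ, DifferentiableOn ℂ l (ball c R) ∧ l c = 0 ∧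
      ∀ w ∈ ball c R, ‖G n w‖ = ‖G n c‖ * Real.exp (l w).re := by
    filter_upwards [hd, h0] with n hdn h0n using exists_log_quotient_on_ball hR hdn h0n
  obtain ⟨l, hl⟩ := hlog.choice
  obtain ⟨ρ, hzρ, hρR⟩ := exists_between (mem_ball.mp hz)
  have hρ : 0 < ρ := dist_nonneg.trans_lt hzρ
  set M : ℝ := |Real.log K| + |Real.log a| + 1 with hMdef
  have hM : 0 < M := by positivity
  have hc : ∀ᶠ n in atTop, a ≤ ‖G n c‖ ∧ ‖G n c‖ ≤ b :=
    hab.mono fun n hn ↦ hn c (mem_ball_self hr)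
  have hlim : Tendsto (fun n : ℕ ↦ l n z / n) atTop (𝓝 0) := by
    refine tendsto_zero_of_bounded_of_tendsto_zero_near (ψ := fun n w ↦ l n w / n) (R := ρ)
      (M := 2 * M * ρ / (R - ρ)) (r := r / 2) (c := c)
      (e := fun n ↦ 2 * ((|Real.log (b / a)| + 1) / n)) (by positivity) ?_ ?_ ?_ ?_ hzρ
    · filter_upwards [hl] with n hn
      exact (hn.1.mono (ball_subset_ball hρR.le)).div_const _
    · filter_upwards [hl, hGK, hc, eventually_ge_atTop 1] with n hn hKn hcn hn1 w hw
      have hn1' : (1 : ℝ) ≤ n := by exact_mod_cast hn1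
      refine norm_le_of_re_le_of_apply_eq_zero (f := fun w ↦ l n w / n) hM hρR (hn.1.div_const _) (fun w hw ↦ ?_)
        (by simp [hn.2.1]) hw
      rw [div_natCast_re, div_le_iff₀ (by positivity)]
      have h1 : a * Real.exp (l n w).re ≤ K ^ n :=
        calc _ ≤ ‖G n c‖ * Real.exp (l n w).re := by gcongr; exact hcn.1
          _ = ‖G n w‖ := (hn.2.2 w hw).symm
          _ ≤ _ := hKn w hw
      have h2 := Real.log_le_log (by positivity) h1
      rw [Real.log_mul ha.ne' (Real.exp_ne_zero _), Real.log_exp, Real.log_pow] at h2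
      have h3 : |Real.log a| * 1 ≤ |Real.log a| * n := by gcongr
      have h4 : n * Real.log K ≤ n * |Real.log K| := by gcongr; exact le_abs_self _
      rw [hMdef]
      linarith [neg_abs_le (Real.log a)]
    · have := (tendsto_const_div_atTop_nhds_zero_nat (|Real.log (b / a)| + 1)).const_mul 2
      simpa using this
    · filter_upwards [hl, hab, hc, eventually_ge_atTop 1] with n hn habn hcn hn1 w hw
      have hn1' : (1 : ℝ) ≤ n := by exact_mod_cast hn1
      have hsub : ball c r ⊆ ball c R := ball_subset_ball hrR
      have key := norm_le_of_re_le_of_apply_eq_zero (M := (|Real.log (b / a)| + 1) / n)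
        (f := fun w ↦ l n w / n) (c := c) (z := w)
        (by positivity) (half_lt_self hr) ((hn.1.mono hsub).div_const _) (fun w hw ↦ ?_)
        (by simp [hn.2.1]) hw
      · refine key.trans (le_of_eq ?_)
        field_simp
        ring
      · rw [div_natCast_re]
        gcongr
        have h1 : a * Real.exp (l n w).re ≤ b :=
          calc _ ≤ ‖G n c‖ * Real.exp (l n w).re := by gcongr; exact hcn.1
            _ = ‖G n w‖ := (hn.2.2 w (hsub hw)).symm
            _ ≤ _ := (habn w hw).2
        have h2 := Real.log_le_log (Real.exp_pos _) ((le_div_iff₀' ha).mpr h1)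
        rw [Real.log_exp] at h2
        linarith [le_abs_self (Real.log (b / a))]
  have hre : Tendsto (fun n : ℕ ↦ (l n z / n).re) atTop (𝓝 0) := by
    exact (continuous_re.tendsto 0).comp hlim
  have hη0 : 0 < Real.log η := Real.log_pos hη
  have hexp : Tendsto (fun n : ℕ ↦ Real.exp (Real.log η / 2) ^ n) atTop atTop :=
    tendsto_pow_atTop_atTop_of_one_lt (Real.one_lt_exp_iff.mpr (by positivity))
  filter_upwards [hl, hc, hre.eventually_lt_const (half_pos hη0), hexp.eventually_gt_atTop b,
    eventually_ge_atTop 1] with n hn hcn hren hbn hn1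
  have hn1' : (1 : ℝ) ≤ n := by exact_mod_cast hn1
  rw [div_natCast_re, div_lt_iff₀ (by positivity)] at hren
  have hb : 0 < b := ha.trans_le (hcn.1.trans hcn.2)
  calc ‖G n z‖ = ‖G n c‖ * Real.exp (l n z).re := hn.2.2 z hz
    _ ≤ b * Real.exp (Real.log η / 2 * n) := by gcongr; exact hcn.2
    _ < Real.exp (Real.log η / 2) ^ n * Real.exp (Real.log η / 2 * n) := by gcongr
    _ = η ^ n := by
      rw [← Real.exp_nat_mul, ← Real.exp_add]
      conv_rhs => rw [← Real.exp_log (zero_lt_one.trans hη), ← Real.exp_nat_mul]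
      congr 1; ring

theorem iteratedDeriv_inv_sub_pow (p : ℂ) (j n : ℕ) (w : ℂ) :
    iteratedDeriv n (fun z : ℂ ↦ ((z - p) ^ (j + 1))⁻¹) w =
      (-1) ^ n * n.factorial * (n + j).choose j * ((w - p) ^ (n + j + 1))⁻¹ := by
  have hz : (fun z : ℂ ↦ ((z - p) ^ (j + 1))⁻¹) =
      fun z ↦ (fun y : ℂ ↦ y ^ (-(j + 1 : ℕ) : ℤ)) (z - p) := by
    ext z
    simp only [zpow_neg, zpow_natCast]
  have hprod : ∏ i ∈ Finset.range n, (((-(j + 1 : ℕ) : ℤ) : ℂ) - i) =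
      (-1) ^ n * n.factorial * (n + j).choose j := by
    induction n with
    | zero => simp
    | succ n ih =>
      have h : ((n + 1 + j).choose j : ℂ) * (n + 1) = (n + j).choose j * (n + 1 + j) := by
        have := Nat.choose_mul_succ_eq (n + j) j
        rw [show n + j + 1 - j = n + 1 by omega, show n + j + 1 = n + 1 + j by ring] at this
        exact_mod_cast this.symm
      rw [Finset.prod_range_succ, ih, Nat.factorial_succ]
      push_cast
      linear_combination (-(-1) ^ (n + 1) * (n.factorial : ℂ)) * h
  rw [hz, iteratedDeriv_comp_sub_const (f := fun y : ℂ ↦ y ^ (-(j + 1 : ℕ) : ℤ)), iteratedDeriv_eq_iterate]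
  beta_reduce
  rw [iter_deriv_zpow, hprod]
  congr 1
  rw [← zpow_natCast, ← zpow_neg]
  congr 1
  push_cast
  ring

theorem Polynomial.exists_eval_eq_mul_add (P V : Polynomial ℂ) (p : ℂ) (hV : V.eval p ≠ 0) :
    ∃ (β : ℂ) (P' : Polynomial ℂ), β * V.eval p = P.eval p ∧
      ∀ z, P.eval z = β * V.eval z + (z - p) * P'.eval z := by
  obtain ⟨P', hP'⟩ := dvd_iff_isRoot.mpr
    (show (P - .C (P.eval p / V.eval p) * V).IsRoot p by simp [hV])
  refine ⟨P.eval p / V.eval p, P', by field_simp, fun z ↦ ?_⟩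
  have := congrArg (eval z) hP'
  simp only [eval_sub, eval_mul, eval_C, eval_X] at this
  linear_combination this

theorem Polynomial.exists_principal_part (P V : Polynomial ℂ) (p : ℂ) (hV : V.eval p ≠ 0)
    (m : ℕ) :
    ∃ (b : ℕ → ℂ) (U : Polynomial ℂ), b m * V.eval p = P.eval p ∧
      ∀ z, z ≠ p → V.eval z ≠ 0 → P.eval z / ((z - p) ^ (m + 1) * V.eval z) =
        ∑ j ∈ Finset.range (m + 1), b j * ((z - p) ^ (j + 1))⁻¹ + U.eval z / V.eval z := by
  induction m generalizing P with
  | zero =>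
    obtain ⟨β, P', hβ, hP'⟩ := P.exists_eval_eq_mul_add V p hV
    refine ⟨fun _ ↦ β, P', hβ, fun z hz hVz ↦ ?_⟩
    have hz' := sub_ne_zero.mpr hz
    rw [hP' z]
    simp
    field_simp
  | succ m ih =>
    obtain ⟨β, P', hβ, hP'⟩ := P.exists_eval_eq_mul_add V p hV
    obtain ⟨b, U, -, h⟩ := ih P'
    refine ⟨Function.update b (m + 1) β, U, by simpa using hβ, fun z hz hVz ↦ ?_⟩
    have hz' := sub_ne_zero.mpr hz
    have hsum : ∑ j ∈ Finset.range (m + 1), Function.update b (m + 1) β j * ((z - p) ^ (j + 1))⁻¹ =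
        ∑ j ∈ Finset.range (m + 1), b j * ((z - p) ^ (j + 1))⁻¹ :=
      Finset.sum_congr rfl fun j hj ↦ by
        rw [Function.update_of_ne (Finset.mem_range.mp hj).ne]
    rw [Finset.sum_range_succ, Function.update_self, hsum, add_right_comm (∑ j ∈ _, _),
      ← h z hz hVz, hP' z]
    field_simp
    ring

theorem Nat.tendsto_choose_add_div_choose_add {j m : ℕ} (hjm : j < m) :
    Tendsto (fun n : ℕ ↦ ((n + j).choose j : ℝ) / (n + m).choose m) atTop (𝓝 0) := by
  have hlim : Tendsto (fun n : ℕ ↦ ((j : ℝ) + 1) / n) atTop (𝓝 0) :=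
    tendsto_const_div_atTop_nhds_zero_nat _
  refine squeeze_zero' (Eventually.of_forall fun n ↦ by positivity) ?_ hlim
  filter_upwards [eventually_ge_atTop 1] with n hn
  have hn' : (0 : ℝ) < n := by exact_mod_cast hn
  have hmono : (n + (j + 1)).choose (j + 1) ≤ (n + m).choose m := by
    rw [Nat.choose_symm_add.symm, Nat.choose_symm_add.symm]
    exact Nat.choose_le_choose n (by omega)
  have hmul : (n + j + 1) * (n + j).choose j = (n + j + 1).choose (j + 1) * (j + 1) :=
    Nat.add_one_mul_choose_eq (n + j) j
  have hpos : (0 : ℝ) < (n + m).choose m := by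
    exact_mod_cast Nat.choose_pos (Nat.le_add_left m n)
  rw [div_le_div_iff₀ hpos hn']
  have h1 : n * (n + j).choose j ≤ (j + 1) * (n + m).choose m := by
    calc n * (n + j).choose j ≤ (n + j + 1) * (n + j).choose j := by gcongr; omega
      _ = (j + 1) * (n + (j + 1)).choose (j + 1) := by rw [hmul, mul_comm, add_assoc]
      _ ≤ _ := by gcongr
  rw [mul_comm]
  exact_mod_cast h1

theorem Nat.tendsto_choose_add_mul_pow (m : ℕ) {r : ℝ} (hr0 : 0 ≤ r) (hr : r < 1) :
    Tendsto (fun n : ℕ ↦ ((n + m).choose m : ℝ) * r ^ n) atTop (𝓝 0) := by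
  have := (summable_choose_mul_geometric_of_norm_lt_one m
    (show ‖r‖ < 1 by rwa [Real.norm_of_nonneg hr0])).tendsto_atTop_zero
  exact this

theorem Complex.dist_add_mul_sub_lt {z p s : ℂ} {t : ℝ} (hps : s ≠ p) (ht0 : 0 < t) (ht1 : t ≤ 1)
    (h : dist z p ≤ dist z s) : dist (z + t * (p - z)) p < dist (z + t * (p - z)) s := by
  have hid : dist (z + t * (p - z)) s ^ 2 - dist (z + t * (p - z)) p ^ 2 =
      (1 - t) * (dist z s ^ 2 - dist z p ^ 2) + t * ‖s - p‖ ^ 2 := by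
    simp only [dist_eq, Complex.sq_norm, normSq_apply, sub_re, sub_im, add_re, add_im, mul_re, mul_im,
      ofReal_re, ofReal_im]
    ring
  have h1 : 0 ≤ (1 - t) * (dist z s ^ 2 - dist z p ^ 2) :=
    mul_nonneg (by linarith) (sub_nonneg.mpr (by gcongr))
  have h2 : 0 < t * ‖s - p‖ ^ 2 := by
    have := norm_pos_iff.mpr (sub_ne_zero.mpr hps)
    positivity
  exact lt_of_pow_lt_pow_left₀ 2 dist_nonneg (by linarith)

theorem Polynomial.exists_ball_forall_eval_ne_zero {V : Polynomial ℂ} (hV : V ≠ 0) {z : ℂ} {d : ℝ}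
    (h : ∀ s, V.eval s = 0 → d < dist z s) :
    ∃ ρ, d < ρ ∧ ∀ w ∈ closedBall z ρ, V.eval w ≠ 0 := by
  have hev : ∀ᶠ x in 𝓝[>] d, ∀ s ∈ V.roots.toFinset, x < dist z s :=
    (Finset.eventually_all _).mpr fun s hs ↦ nhdsWithin_le_nhds <| Iio_mem_nhds <|
      h s (by simpa [hV] using hs)
  obtain ⟨ρ, hρ, hdρ⟩ := (hev.and self_mem_nhdsWithin).exists
  refine ⟨ρ, hdρ, fun w hw hw0 ↦ ?_⟩
  have := hρ w (by simpa [hV] using hw0)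
  exact absurd (mem_closedBall'.mp hw) (not_le.mpr this)

theorem exists_iteratedDeriv_eq_sum_add (P Q : Polynomial ℂ) (hPQ : IsCoprime P Q) (hQ : Q ≠ 0)
    {p : ℂ} (hp : Q.eval p = 0) {f : ℂ → ℂ}
    (hf : ∀ z : ℂ, Q.eval z ≠ 0 → f z = P.eval z / Q.eval z) :
    ∃ (m : ℕ) (b : ℕ → ℂ) (U V : Polynomial ℂ), b m ≠ 0 ∧ V.eval p ≠ 0 ∧ V ∣ Q ∧
      ∀ (n : ℕ) (w : ℂ), Q.eval w ≠ 0 →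
        (-1) ^ n * (n.factorial : ℂ)⁻¹ * iteratedDeriv n f w * (w - p) ^ (n + m + 1) =
          ∑ j ∈ Finset.range (m + 1), b j * (n + j).choose j * (w - p) ^ (m - j) +
          (-1) ^ n * (n.factorial : ℂ)⁻¹ * iteratedDeriv n (fun z ↦ U.eval z / V.eval z) w *
            (w - p) ^ (n + m + 1) := by
  obtain ⟨V, hQV, hVdvd⟩ := Q.exists_eq_pow_rootMultiplicity_mul_and_not_dvd hQ p
  obtain ⟨m, hm⟩ := Nat.exists_eq_succ_of_ne_zero
    ((Polynomial.rootMultiplicity_pos hQ).mpr hp).ne'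
  rw [hm] at hQV
  have hV : V.eval p ≠ 0 := fun h ↦ hVdvd (Polynomial.dvd_iff_isRoot.mpr h)
  have hP : P.eval p ≠ 0 := fun h ↦ by
    obtain ⟨u, v, huv⟩ := hPQ
    simpa [h, hp] using congrArg (Polynomial.eval p) huv
  obtain ⟨b, U, hb, hpart⟩ := P.exists_principal_part V p hV m
  refine ⟨m, b, U, V, fun h ↦ hP (by rw [← hb, h, zero_mul]), hV, ⟨_, by rw [hQV, mul_comm]⟩, ?_⟩
  have hQeval : ∀ z, Q.eval z = (z - p) ^ (m + 1) * V.eval z := fun z ↦ by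
    conv_lhs => rw [hQV]
    simp
  intro n w hw
  have hne : ∀ z, Q.eval z ≠ 0 → z ≠ p ∧ V.eval z ≠ 0 := fun z hz ↦
    ⟨fun h ↦ hz (h ▸ hp), fun h ↦ hz (by rw [hQeval, h, mul_zero])⟩
  have hev : f =ᶠ[𝓝 w] fun z ↦
      ∑ j ∈ Finset.range (m + 1), b j * ((z - p) ^ (j + 1))⁻¹ + U.eval z / V.eval z := by
    filter_upwards [Q.continuous.continuousAt.eventually_ne hw] with z hz
    rw [hf z hz, hQeval, hpart z (hne z hz).1 (hne z hz).2]
  have hwp : w - p ≠ 0 := sub_ne_zero.mpr (hne w hw).1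
  have hpow : ∀ j, ContDiffAt ℂ n (fun z : ℂ ↦ ((z - p) ^ (j + 1))⁻¹) w := fun j ↦
    ContDiffAt.inv (by fun_prop) (pow_ne_zero _ hwp)
  have hUV : ContDiffAt ℂ n (fun z ↦ U.eval z / V.eval z) w :=
    U.differentiable.contDiff.contDiffAt.div V.differentiable.contDiff.contDiffAt (hne w hw).2
  rw [hev.iteratedDeriv_eq, iteratedDeriv_fun_add
    (ContDiffAt.sum fun j _ ↦ contDiffAt_const.mul (hpow j)) hUV,
    iteratedDeriv_fun_sum fun j _ ↦ contDiffAt_const.mul (hpow j), mul_add, add_mul]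
  congr 1
  rw [Finset.mul_sum, Finset.sum_mul]
  refine Finset.sum_congr rfl fun j hj ↦ ?_
  have hfac : (n.factorial : ℂ) ≠ 0 := by exact_mod_cast n.factorial_ne_zero
  have hsign : ((-1 : ℂ) ^ n) * (-1) ^ n = 1 := by rw [← mul_pow]; simp
  have hsplit : (w - p) ^ (n + m + 1) = (w - p) ^ (n + j + 1) * (w - p) ^ (m - j) := by
    rw [← pow_add]
    congr 1
    have := Finset.mem_range.mp hj
    omega
  rw [iteratedDeriv_const_mul_field, iteratedDeriv_inv_sub_pow, hsplit]
  field_simp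
  linear_combination (b j * (n + j).choose j) * hsign

theorem exists_norm_iteratedDeriv_bounds (P Q : Polynomial ℂ) (hPQ : IsCoprime P Q) (hQ : Q ≠ 0)
    {p z : ℂ} (hp : Q.eval p = 0) (hnear : ∀ s, Q.eval s = 0 → s ≠ p → dist z p < dist z s)
    {f : ℂ → ℂ} (hf : ∀ z : ℂ, Q.eval z ≠ 0 → f z = P.eval z / Q.eval z) :
    ∃ (m : ℕ) (a b δ : ℝ), 0 < a ∧ 0 < δ ∧
      ∀ᶠ n : ℕ in atTop, ∀ w ∈ ball z δ, Q.eval w ≠ 0 →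
        a * (n + m).choose m ≤ ‖iteratedDeriv n f w‖ / n.factorial * ‖w - p‖ ^ (n + m + 1) ∧
        ‖iteratedDeriv n f w‖ / n.factorial * ‖w - p‖ ^ (n + m + 1) ≤ b * (n + m).choose m := by
  obtain ⟨m, b, U, V, hb, hV, hVQ, hD⟩ := exists_iteratedDeriv_eq_sum_add P Q hPQ hQ hp hf
  have hV0 : V ≠ 0 := fun h ↦ hV (by simp [h])
  obtain ⟨ρ, hdρ, hρ⟩ := Polynomial.exists_ball_forall_eval_ne_zero hV0 (z := z) (d := dist z p)
    fun s hs ↦ hnear s (Polynomial.eval_eq_zero_of_dvd_of_eval_eq_zero hVQ hs)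
      fun h ↦ hV (h ▸ hs)
  set h : ℂ → ℂ := fun z ↦ U.eval z / V.eval z with hh
  have hhd : DifferentiableOn ℂ h {w | V.eval w ≠ 0} := fun w hw ↦
    (U.differentiable.differentiableAt.div V.differentiable.differentiableAt
      hw).differentiableWithinAt
  obtain ⟨M, hM⟩ := (isCompact_closedBall z ρ).exists_bound_of_continuousOn
    (hhd.continuousOn.mono hρ)
  set δ : ℝ := (ρ - dist z p) / 3 with hδ
  have hδ0 : 0 < δ := by rw [hδ]; linarith
  have hd0 : 0 ≤ dist z p := dist_nonneg
  set B : ℝ := dist z p + δ with hB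
  set r : ℝ := B + δ with hr
  have hB0 : 0 < B := by positivity
  have hr0 : 0 < r := by positivity
  have hM0 : 0 ≤ M := (norm_nonneg _).trans (hM z (mem_closedBall_self (by linarith)))
  have hrest : ∀ (n : ℕ), ∀ w ∈ ball z δ,
      ‖(-1) ^ n * (n.factorial : ℂ)⁻¹ * iteratedDeriv n h w * (w - p) ^ (n + m + 1)‖ ≤
        M * B ^ (m + 1) * (B / r) ^ n := by
    intro n w hw
    have hwp : ‖w - p‖ ≤ B := by
      rw [← dist_eq_norm]
      linarith [dist_triangle w z p, mem_ball.mp hw]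
    have hsub : closedBall w r ⊆ closedBall z ρ := closedBall_subset_closedBall' (by
      rw [hr, hB]; linarith [mem_ball.mp hw])
    have hc := norm_iteratedDeriv_le_of_forall_mem_sphere_norm_le n hr0
      (hhd.diffContOnCl_ball (hsub.trans hρ))
      fun x hx ↦ hM x (hsub (sphere_subset_closedBall hx))
    have hk : (0 : ℝ) < n.factorial := by exact_mod_cast n.factorial_pos
    simp only [norm_mul, norm_pow, norm_neg, norm_one, one_pow, one_mul, norm_inv, norm_natCast]
    calc _ ≤ (n.factorial : ℝ)⁻¹ * (n.factorial * M / r ^ n) * B ^ (n + m + 1) := by gcongr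
      _ = _ := by rw [div_pow, add_assoc, pow_add]; field_simp
  have he : Tendsto (fun n : ℕ ↦ ∑ j ∈ Finset.range m,
      ‖b j‖ * B ^ (m - j) * (((n + j).choose j : ℝ) / (n + m).choose m) +
        M * B ^ (m + 1) * (B / r) ^ n) atTop (𝓝 0) := by
    have h1 := tendsto_finsetSum (Finset.range m) fun j hj ↦
      (Nat.tendsto_choose_add_div_choose_add (Finset.mem_range.mp hj)).const_mul
        (‖b j‖ * B ^ (m - j))
    have h2 := (tendsto_pow_atTop_nhds_zero_of_lt_one (div_nonneg hB0.le hr0.le)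
      ((div_lt_one hr0).mpr (by linarith))).const_mul (M * B ^ (m + 1))
    simpa using h1.add h2
  have hβ : 0 < ‖b m‖ := norm_pos_iff.mpr hb
  refine ⟨m, ‖b m‖ / 2, 2 * ‖b m‖, δ, by positivity, hδ0, ?_⟩
  filter_upwards [he.eventually_lt_const (half_pos hβ)] with n hn w hw hQw
  have hC : (1 : ℝ) ≤ (n + m).choose m := by
    exact_mod_cast Nat.choose_pos (Nat.le_add_left m n)
  have hwp : ‖w - p‖ ≤ B := by
    rw [← dist_eq_norm]
    linarith [dist_triangle w z p, mem_ball.mp hw]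
  set X : ℂ := (-1) ^ n * (n.factorial : ℂ)⁻¹ * iteratedDeriv n f w * (w - p) ^ (n + m + 1) with hX
  have hXnorm : ‖iteratedDeriv n f w‖ / n.factorial * ‖w - p‖ ^ (n + m + 1) = ‖X‖ := by
    simp only [hX, norm_mul, norm_pow, norm_neg, norm_one, one_pow, one_mul, norm_inv,
      norm_natCast]
    ring
  have herr : ‖X - b m * (n + m).choose m‖ ≤ ‖b m‖ / 2 * (n + m).choose m := by
    have hXe : X - b m * (n + m).choose m =
        ∑ j ∈ Finset.range m, b j * (n + j).choose j * (w - p) ^ (m - j) +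
          (-1) ^ n * (n.factorial : ℂ)⁻¹ * iteratedDeriv n h w * (w - p) ^ (n + m + 1) := by
      rw [hX, hD n w hQw, Finset.sum_range_succ, Nat.sub_self, pow_zero]
      ring
    calc ‖X - b m * (n + m).choose m‖
        ≤ ∑ j ∈ Finset.range m, ‖b j‖ * (n + j).choose j * B ^ (m - j) +
          M * B ^ (m + 1) * (B / r) ^ n := by
          rw [hXe]
          refine (norm_add_le _ _).trans (add_le_add ?_ (hrest n w hw))
          refine (norm_sum_le _ _).trans (Finset.sum_le_sum fun j _ ↦ ?_)
          rw [norm_mul, norm_mul, norm_pow, norm_natCast]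
          gcongr
      _ ≤ ∑ j ∈ Finset.range m, ‖b j‖ * (n + j).choose j * B ^ (m - j) +
          M * B ^ (m + 1) * (B / r) ^ n * (n + m).choose m :=
          add_le_add_right (le_mul_of_one_le_right (by positivity) hC) _
      _ = (∑ j ∈ Finset.range m,
          ‖b j‖ * B ^ (m - j) * (((n + j).choose j : ℝ) / (n + m).choose m) +
          M * B ^ (m + 1) * (B / r) ^ n) * (n + m).choose m := by
          rw [add_mul, Finset.sum_mul]
          congr 1
          refine Finset.sum_congr rfl fun j _ ↦ ?_
          field_simp
      _ ≤ _ := by gcongr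
  have hbC : ‖b m * (n + m).choose m‖ = ‖b m‖ * (n + m).choose m := by
    rw [norm_mul, norm_natCast]
  have hpos : 0 ≤ ‖b m‖ * (n + m).choose m := by positivity
  have h1 := norm_sub_norm_le (b m * (n + m).choose m : ℂ) X
  have h2 := norm_sub_norm_le X (b m * (n + m).choose m : ℂ)
  rw [norm_sub_rev] at h1
  rw [hXnorm]
  constructor <;> linarith

theorem exists_iteratedDeriv_eq_zero_near_equidistant (P Q : Polynomial ℂ) (hPQ : IsCoprime P Q)
    (hQ : Q ≠ 0) {p q z : ℂ} (hp : Q.eval p = 0) (hq : Q.eval q = 0) (hpq : p ≠ q)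
    (heq : dist z p = dist z q) (hmin : ∀ s, Q.eval s = 0 → dist z p ≤ dist z s)
    {f : ℂ → ℂ} (hf : ∀ z : ℂ, Q.eval z ≠ 0 → f z = P.eval z / Q.eval z) {ε : ℝ} (hε : 0 < ε) :
    ∃ᶠ n in atTop, ∃ w : ℂ, Q.eval w ≠ 0 ∧ iteratedDeriv n f w = 0 ∧ dist w z < ε := by
  by_contra hcon
  rw [not_frequently] at hcon
  set d := dist z p with hd
  have hd0 : 0 < d := by
    refine dist_pos.mpr fun h ↦ hpq ?_
    rw [hd, h, dist_self] at heq
    exact dist_eq_zero.mp heq.symm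
  set σ := min ε d / 4 with hσ
  have hσ0 : 0 < σ := by positivity
  have hσε : 4 * σ ≤ ε := by rw [hσ]; linarith [min_le_left ε d]
  have hσd : 4 * σ ≤ d := by rw [hσ]; linarith [min_le_right ε d]
  clear_value σ
  have hΩ : closedBall z (2 * σ) ⊆ {w | Q.eval w ≠ 0} := fun w hw h ↦ by
    have := mem_closedBall'.mp hw
    linarith [hmin w h]
  have hfd : DifferentiableOn ℂ f {w | Q.eval w ≠ 0} := by
    refine DifferentiableOn.congr (f := fun z ↦ P.eval z / Q.eval z) (fun w hw ↦ ?_) hf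
    exact (P.differentiable.differentiableAt.div Q.differentiable.differentiableAt
      hw).differentiableWithinAt
  obtain ⟨M, hM⟩ := (isCompact_closedBall z (2 * σ)).exists_bound_of_continuousOn
    (hfd.continuousOn.mono hΩ)
  have hM0 : 0 ≤ M := (norm_nonneg _).trans (hM z (mem_closedBall_self (by positivity)))
  set t : ℝ := σ / (8 * d) with ht
  have ht0 : 0 < t := by positivity
  have htd : t * d = σ / 8 := by rw [ht]; field_simp
  have ht1 : t < 1 := by nlinarith
  set z₁ := z + t * (p - z) with hz₁
  set z₂ := z + t * (q - z) with hz₂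
  have hdist : ∀ x : ℂ, dist z x = d → dist (z + t * (x - z)) z = σ / 8 := fun x hx ↦ by
    rw [dist_eq, add_sub_cancel_left, norm_mul, norm_real, Real.norm_of_nonneg ht0.le,
      ← dist_eq, dist_comm, hx, htd]
  have hz₁z : dist z₁ z = σ / 8 := hdist p rfl
  have hz₂z : dist z₂ z = σ / 8 := hdist q heq.symm
  obtain ⟨m, a, b, δ, ha, hδ, hab⟩ := exists_norm_iteratedDeriv_bounds P Q hPQ hQ hp
    (z := z₁) (fun s hs hsp ↦ dist_add_mul_sub_lt hsp ht0 ht1.le (hmin s hs)) hf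
  obtain ⟨m', a', b', δ', ha', hδ', hab'⟩ := exists_norm_iteratedDeriv_bounds P Q hPQ hQ hq
    (z := z₂) (fun s hs hsp ↦ dist_add_mul_sub_lt hsp ht0 ht1.le (heq ▸ hmin s hs)) hf
  have hXY : dist z₂ q < dist z₂ p := dist_add_mul_sub_lt hpq ht0 ht1.le heq.symm.le
  have hY0 : 0 < dist z₂ q := by
    have := dist_triangle z z₂ q
    rw [dist_comm z z₂] at this
    linarith
  have hX0 : 0 < dist z₂ p := hY0.trans hXY
  obtain ⟨η, hη1, hηκ⟩ := exists_between ((one_lt_div hY0).mpr hXY)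
  have hsub : ball z₁ (σ / 2) ⊆ ball z σ :=
    ball_subset_ball' (by linarith)
  have hballΩ : ∀ w ∈ ball z σ, Q.eval w ≠ 0 := fun w hw ↦
    hΩ (ball_subset_closedBall.trans (closedBall_subset_closedBall (by linarith)) hw)
  have hzΩ : ∀ w ∈ ball z₁ (σ / 2), Q.eval w ≠ 0 := fun w hw ↦ hballΩ w (hsub hw)
  have hC : ∀ n : ℕ, (1 : ℝ) ≤ (n + m).choose m := fun n ↦ by
    exact_mod_cast Nat.choose_pos (Nat.le_add_left m n)
  set G : ℕ → ℂ → ℂ := fun n w ↦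
    iteratedDeriv n f w / n.factorial * (w - p) ^ (n + m + 1) / (n + m).choose m with hG
  have hGnorm : ∀ n w, ‖G n w‖ =
      ‖iteratedDeriv n f w‖ / n.factorial * ‖w - p‖ ^ (n + m + 1) / (n + m).choose m :=
    fun n w ↦ by simp [hG]
  have hfan : AnalyticOnNhd ℂ f {w | Q.eval w ≠ 0} :=
    hfd.analyticOnNhd (isOpen_ne_fun Q.continuous continuous_const)
  have hz₂mem : z₂ ∈ ball z₁ (σ / 2) := by
    rw [mem_ball]
    linarith [dist_triangle_right z₂ z₁ z]
  have hmain : ∀ᶠ n in atTop, ‖G n z₂‖ < η ^ n := by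
    refine eventually_norm_lt_pow_of_ne_zero (c := z₁) (R := σ / 2) (r := min δ (σ / 2)) (a := a)
      (b := b) (K := (M * (2 * d) ^ (m + 1) + 1) * (2 * d / σ)) (by positivity)
      (min_le_right _ _) hz₂mem ha hη1 ?_ ?_ ?_ ?_
    · refine Eventually.of_forall fun n ↦ ?_
      have h : DifferentiableOn ℂ (iteratedDeriv n f) (ball z₁ (σ / 2)) := fun w hw ↦ by
        rw [iteratedDeriv_eq_iterate]
        exact ((hfan w (hzΩ w hw)).iterated_deriv n).differentiableWithinAt
      fun_prop
    · filter_upwards [hcon] with n hn w hw hGw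
      have hw' := hsub hw
      have hnf : iteratedDeriv n f w ≠ 0 := fun h ↦
        hn ⟨w, hzΩ w hw, h, by linarith [mem_ball.mp hw']⟩
      have hwp : w - p ≠ 0 := sub_ne_zero.mpr fun h ↦ hzΩ w hw (h ▸ hp)
      have hCn : ((n + m).choose m : ℂ) ≠ 0 := by
        exact_mod_cast (Nat.choose_pos (Nat.le_add_left m n)).ne'
      have hfac : (n.factorial : ℂ) ≠ 0 := by exact_mod_cast n.factorial_ne_zero
      exact div_ne_zero (mul_ne_zero (div_ne_zero hnf hfac) (pow_ne_zero _ hwp)) hCn hGw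
    · filter_upwards [eventually_ge_atTop 1] with n hn w hw
      have hw' := mem_ball.mp (hsub hw)
      have hwσ : closedBall w σ ⊆ closedBall z (2 * σ) :=
        closedBall_subset_closedBall' (by linarith)
      have hc := norm_iteratedDeriv_le_of_forall_mem_sphere_norm_le n hσ0
        (hfd.diffContOnCl_ball (hwσ.trans hΩ))
        fun x hx ↦ hM x (hwσ (sphere_subset_closedBall hx))
      have hwp : ‖w - p‖ ≤ 2 * d := by
        rw [← dist_eq_norm]
        linarith [dist_triangle w z p]
      have hk : (0 : ℝ) < n.factorial := by exact_mod_cast n.factorial_pos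
      rw [hGnorm]
      refine (div_le_self (by positivity) (hC n)).trans ?_
      calc _ ≤ n.factorial * M / σ ^ n / n.factorial * (2 * d) ^ (n + m + 1) := by gcongr
        _ = M * (2 * d) ^ (m + 1) * (2 * d / σ) ^ n := by
          rw [div_pow, add_assoc, pow_add]; field_simp
        _ ≤ (M * (2 * d) ^ (m + 1) + 1) ^ n * (2 * d / σ) ^ n := by
          gcongr
          exact (le_add_of_nonneg_right zero_le_one).trans
            (le_self_pow₀ (le_add_of_nonneg_left (by positivity)) (by omega))
        _ = _ := (mul_pow _ _ _).symm
    · filter_upwards [hab] with n hn w hw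
      have hCn := zero_lt_one.trans_le (hC n)
      obtain ⟨h1, h2⟩ := hn w (ball_subset_ball (min_le_left _ _) hw)
        (hzΩ w (ball_subset_ball (min_le_right _ _) hw))
      rw [hGnorm]
      exact ⟨(le_div_iff₀ hCn).mpr h1, (div_le_iff₀ hCn).mpr h2⟩
  set X := dist z₂ p with hX
  set Y := dist z₂ q with hY
  have hηXY : η / (X / Y) < 1 := (div_lt_one (by positivity)).mpr hηκ
  have hη0 : 0 < η := zero_lt_one.trans hη1
  have hlim := (Nat.tendsto_choose_add_mul_pow m (by positivity) hηXY).mul_const (Y ^ (m' + 1))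
  rw [zero_mul] at hlim
  have hlow : 0 < a' * X ^ (m + 1) := by positivity
  obtain ⟨n, hn, hnG, hnab⟩ := ((hlim.eventually_lt_const hlow).and (hmain.and hab')).exists
  have hC' : (1 : ℝ) ≤ (n + m').choose m' := by
    exact_mod_cast Nat.choose_pos (Nat.le_add_left m' n)
  have hCn := zero_lt_one.trans_le (hC n)
  have h1 := (hnab z₂ (mem_ball_self hδ') (hzΩ z₂ hz₂mem)).1
  rw [hGnorm, div_lt_iff₀ hCn, ← dist_eq_norm, ← hX] at hnG
  rw [← dist_eq_norm, ← hY] at h1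
  refine lt_irrefl (a' * X ^ (m + 1) * X ^ n) ?_
  calc a' * X ^ (m + 1) * X ^ n
      ≤ a' * (n + m').choose m' * (X ^ (m + 1) * X ^ n) := by
        rw [mul_assoc]
        gcongr
        exact le_mul_of_one_le_right ha'.le hC'
    _ ≤ ‖iteratedDeriv n f z₂‖ / n.factorial * Y ^ (n + m' + 1) * (X ^ (m + 1) * X ^ n) := by
        gcongr
    _ = ‖iteratedDeriv n f z₂‖ / n.factorial * X ^ (n + m + 1) * Y ^ (n + m' + 1) := by ring
    _ ≤ η ^ n * (n + m).choose m * Y ^ (n + m' + 1) := by gcongr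
    _ = (n + m).choose m * (η / (X / Y)) ^ n * Y ^ (m' + 1) * X ^ n := by
        rw [div_pow, div_pow]
        field_simp
        ring
    _ < a' * X ^ (m + 1) * X ^ n := by gcongr

/-- **Pólya's shire theorem for rational functions.** For a rational function
`f = P/Q` with `P, Q` coprime and `deg Q ≥ 1`, the zeros of the iterated
derivatives of `f` accumulate in `ℂ` exactly on the edges and vertices of the
Voronoi diagram of the set `S` of poles of `f`. -/
theorem polya_shire_rational
    (P Q : Polynomial ℂ) (hPQ : IsCoprime P Q) (hQ : 1 ≤ Q.natDegree)
    (S : Set ℂ) (hS : S = {z : ℂ | Q.eval z = 0})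
    (f : ℂ → ℂ) (hf : ∀ z : ℂ, Q.eval z ≠ 0 → f z = P.eval z / Q.eval z) :
    {z : ℂ | ∀ ε > 0, {n : ℕ | ∃ w : ℂ, Q.eval w ≠ 0 ∧
        iteratedDeriv n f w = 0 ∧ dist w z < ε}.Infinite}
      =
    {z : ℂ | ∃ p ∈ S, ∃ q ∈ S, p ≠ q ∧
        dist z p = dist z q ∧ dist z p = Metric.infDist z S} := by
  have hQ0 : Q ≠ 0 := fun h ↦ by simp [h] at hQ
  have hmem : ∀ s, s ∈ S ↔ Q.eval s = 0 := fun s ↦ by rw [hS]; rfl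
  have hfin : S.Finite := by
    refine Q.roots.toFinset.finite_toSet.subset fun s hs ↦ ?_
    simpa [hQ0] using (hmem s).mp hs
  have hne : S.Nonempty := by
    obtain ⟨s, hs⟩ := IsAlgClosed.exists_root Q
      (Polynomial.natDegree_pos_iff_degree_pos.mp hQ).ne'
    exact ⟨s, (hmem s).mpr hs⟩
  ext z
  constructor
  · intro hz
    obtain ⟨p, hpS, hp⟩ := hfin.isCompact.exists_infDist_eq_dist hne z
    by_contra hcon
    have hnear : ∀ s, Q.eval s = 0 → s ≠ p → dist z p < dist z s := fun s hs hsp ↦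
      (hp ▸ infDist_le_dist_of_mem ((hmem s).mpr hs)).lt_of_ne fun h ↦
        hcon ⟨p, hpS, s, (hmem s).mpr hs, hsp.symm, h, hp.symm⟩
    obtain ⟨m, a, b, δ, ha, hδ, hab⟩ :=
      exists_norm_iteratedDeriv_bounds P Q hPQ hQ0 ((hmem p).mp hpS) hnear hf
    obtain ⟨n, ⟨w, hw, hw0, hwz⟩, hn⟩ :=
      ((Nat.frequently_atTop_iff_infinite.mpr (hz δ hδ)).and_eventually hab).exists
    have h := (hn w (mem_ball.mpr hwz) hw).1
    have hC : (0 : ℝ) < (n + m).choose m := by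
      exact_mod_cast Nat.choose_pos (Nat.le_add_left m n)
    rw [hw0, norm_zero, zero_div, zero_mul] at h
    exact absurd h (not_le.mpr (by positivity))
  · rintro ⟨p, hp, q, hq, hpq, heq, hinf⟩ ε hε
    exact Nat.frequently_atTop_iff_infinite.mp <|
      exists_iteratedDeriv_eq_zero_near_equidistant P Q hPQ hQ0 ((hmem p).mp hp) ((hmem q).mp hq)
        hpq heq (fun s hs ↦ hinf ▸ infDist_le_dist_of_mem ((hmem s).mpr hs)) hf hε
end

section
/- Let P and Q be coprime polynomials over ℂ with deg Q ≥ 1, let S ⊆ ℂ be the set of roots of Q, let Ω = {z ∈ ℂ : Q(z) ≠ 0}, and let f(z) = P(z)/Q(z) on Ω. For distinct p, q ∈ S put E_{pq} = { z ∈ ℂ : |z − p| = |z − q| = dist(z, S) }. Then for every continuous compactly supported function φ : ℂ → ℝ, (1/n)·Σ_{w ∈ Ω, f⁽ⁿ⁾(w) = 0} m_n(w)·φ(w) converges, as n → ∞, to Σ_{{p,q} ⊆ S, p ≠ q} ∫_{E_{pq}} φ(z)·|p − q| / (2π·|z − p|·|z − q|) dH¹(z), where m_n(w) is the order of vanishing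 of f⁽ⁿ⁾ at w, the inner sum is over zeros of f⁽ⁿ⁾ in Ω (a finite set), the outer sum on the right is over unordered pairs of distinct poles, and H¹ is the one-dimensional Hausdorff measure on ℂ. -/
open Complex Metric Filter Set Topology MeasureTheory

/-- The polynomial `A` with `(P / Q)⁽ⁿ⁾ = A / (Q * R ^ n)`, where `R` is the monic squarefree
polynomial with the same roots as `Q`. -/
noncomputable def derivNumerator (P Q : Polynomial ℂ) : ℕ → Polynomial ℂ
  | 0 => P
  | n + 1 => Polynomial.derivative (derivNumerator P Q n) * Lagrange.nodal Q.roots.toFinset id -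
      derivNumerator P Q n * ∑ p ∈ Q.roots.toFinset,
        Polynomial.C ((Q.rootMultiplicity p + n : ℕ) : ℂ) *
          Lagrange.nodal (Q.roots.toFinset.erase p) id

theorem notMem_roots_toFinset {Q : Polynomial ℂ} {z : ℂ} (hz : Q.eval z ≠ 0) :
    z ∉ Q.roots.toFinset := by
  intro h
  rw [Multiset.mem_toFinset] at h
  exact hz (Polynomial.isRoot_of_mem_roots h)

theorem eval_nodal_ne_zero {S : Finset ℂ} {z : ℂ} (hz : z ∉ S) :
    (Lagrange.nodal S id).eval z ≠ 0 := by
  rw [Lagrange.eval_nodal, Finset.prod_ne_zero_iff]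
  intro p hp h
  exact hz (by rw [sub_eq_zero.1 h]; exact hp)

theorem eval_nodal_erase {S : Finset ℂ} {p z : ℂ} (hp : p ∈ S) (hz : z ∉ S) :
    (Lagrange.nodal (S.erase p) id).eval z = (Lagrange.nodal S id).eval z / (z - p) := by
  have hzp : z - p ≠ 0 := sub_ne_zero.2 fun h => hz (h ▸ hp)
  rw [Lagrange.nodal_eq_mul_nodal_erase hp, Polynomial.eval_mul]
  simp only [id, Polynomial.eval_sub, Polynomial.eval_X, Polynomial.eval_C]
  field_simp

theorem eval_derivative_nodal {S : Finset ℂ} {z : ℂ} (hz : z ∉ S) :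
    (Polynomial.derivative (Lagrange.nodal S id)).eval z =
      (Lagrange.nodal S id).eval z * ∑ p ∈ S, 1 / (z - p) := by
  rw [Lagrange.derivative_nodal, Polynomial.eval_finsetSum, Finset.mul_sum]
  refine Finset.sum_congr rfl fun p hp => ?_
  rw [eval_nodal_erase hp hz]
  ring

theorem eval_derivative_eq_mul_sum_rootMultiplicity {Q : Polynomial ℂ} {z : ℂ}
    (hz : Q.eval z ≠ 0) :
    (Polynomial.derivative Q).eval z =
      Q.eval z * ∑ p ∈ Q.roots.toFinset, (Q.rootMultiplicity p : ℂ) / (z - p) := by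
  rw [(IsAlgClosed.splits Q).eval_derivative_eq_eval_mul_sum hz, Finset.sum_multiset_map_count]
  simp [div_eq_mul_inv]

theorem eval_derivNumerator_succ {P Q : Polynomial ℂ} (n : ℕ) {z : ℂ} (hz : Q.eval z ≠ 0) :
    (derivNumerator P Q (n + 1)).eval z = (Lagrange.nodal Q.roots.toFinset id).eval z *
      ((Polynomial.derivative (derivNumerator P Q n)).eval z - (derivNumerator P Q n).eval z *
        (∑ p ∈ Q.roots.toFinset, (Q.rootMultiplicity p : ℂ) / (z - p) +
          n * ∑ p ∈ Q.roots.toFinset, 1 / (z - p))) := by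
  have hz' := notMem_roots_toFinset hz
  have key : (∑ p ∈ Q.roots.toFinset, Polynomial.C ((Q.rootMultiplicity p + n : ℕ) : ℂ) *
      Lagrange.nodal (Q.roots.toFinset.erase p) id).eval z =
      (Lagrange.nodal Q.roots.toFinset id).eval z *
        (∑ p ∈ Q.roots.toFinset, (Q.rootMultiplicity p : ℂ) / (z - p) +
          n * ∑ p ∈ Q.roots.toFinset, 1 / (z - p)) := by
    rw [Polynomial.eval_finsetSum, Finset.mul_sum, ← Finset.sum_add_distrib, Finset.mul_sum]
    refine Finset.sum_congr rfl fun p hp => ?_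
    rw [Polynomial.eval_mul, Polynomial.eval_C, eval_nodal_erase hp hz']
    push_cast
    ring
  rw [derivNumerator, Polynomial.eval_sub, Polynomial.eval_mul, Polynomial.eval_mul, key]
  ring

theorem iteratedDeriv_eq_derivNumerator_div {P Q : Polynomial ℂ} {f : ℂ → ℂ}
    (hf : ∀ z : ℂ, Q.eval z ≠ 0 → f z = P.eval z / Q.eval z) (n : ℕ) {z : ℂ}
    (hz : Q.eval z ≠ 0) :
    iteratedDeriv n f z = (derivNumerator P Q n).eval z /
      (Q.eval z * (Lagrange.nodal Q.roots.toFinset id).eval z ^ n) := by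
  induction n generalizing z with
  | zero => simp [derivNumerator, hf z hz]
  | succ n ih =>
    set R := Lagrange.nodal Q.roots.toFinset id with hR
    have hz' := notMem_roots_toFinset hz
    have hRz : R.eval z ≠ 0 := eval_nodal_ne_zero hz'
    have hev : iteratedDeriv n f =ᶠ[𝓝 z] fun w => (derivNumerator P Q n).eval w /
        (Q.eval w * R.eval w ^ n) := by
      filter_upwards [Q.continuous.continuousAt.eventually_ne hz] with w hw using ih hw
    have hd := ((derivNumerator P Q n).hasDerivAt z).fun_div
      ((Q.hasDerivAt z).fun_mul ((R.hasDerivAt z).fun_pow n)) (mul_ne_zero hz (pow_ne_zero n hRz))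
    rw [iteratedDeriv_succ, hev.deriv_eq, hd.deriv, eval_derivNumerator_succ n hz, ← hR,
      hR, eval_derivative_nodal hz', ← hR, eval_derivative_eq_mul_sum_rootMultiplicity hz]
    generalize ∑ p ∈ Q.roots.toFinset, (Q.rootMultiplicity p : ℂ) / (z - p) = a
    generalize ∑ p ∈ Q.roots.toFinset, 1 / (z - p) = b
    rcases n with _ | n
    · simp only [pow_zero, Nat.cast_zero]
      field_simp
      ring
    · simp only [Nat.add_sub_cancel]
      field_simp
      ring

theorem natDegree_derivNumerator_le (P Q : Polynomial ℂ) (n : ℕ) :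
    (derivNumerator P Q n).natDegree ≤ P.natDegree + n * Q.roots.toFinset.card := by
  induction n with
  | zero => simp [derivNumerator]
  | succ n ih =>
    rw [derivNumerator]
    refine (Polynomial.natDegree_sub_le _ _).trans (max_le ?_ ?_)
    · refine Polynomial.natDegree_mul_le.trans ?_
      rw [Lagrange.natDegree_nodal]
      have := Polynomial.natDegree_derivative_le (derivNumerator P Q n)
      rw [add_mul, one_mul]
      omega
    · refine Polynomial.natDegree_mul_le.trans ?_
      have : (∑ p ∈ Q.roots.toFinset, Polynomial.C ((Q.rootMultiplicity p + n : ℕ) : ℂ) *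
          Lagrange.nodal (Q.roots.toFinset.erase p) id).natDegree ≤ Q.roots.toFinset.card := by
        refine Polynomial.natDegree_sum_le_of_forall_le _ _ fun p _ => ?_
        refine (Polynomial.natDegree_C_mul_le _ _).trans ?_
        rw [Lagrange.natDegree_nodal]
        exact Finset.card_erase_le
      rw [add_mul, one_mul]
      omega

theorem eval_derivNumerator_root_ne_zero {P Q : Polynomial ℂ} (hPQ : IsCoprime P Q) (n : ℕ)
    {p : ℂ} (hp : p ∈ Q.roots.toFinset) : (derivNumerator P Q n).eval p ≠ 0 := by
  have hp' := Multiset.mem_toFinset.1 hp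
  induction n with
  | zero =>
    obtain ⟨a, b, hab⟩ := hPQ
    intro h
    have := congrArg (Polynomial.eval p) hab
    rw [derivNumerator] at h
    simp [h, (Polynomial.isRoot_of_mem_roots hp').eq_zero] at this
  | succ n ih =>
    have hsum : (∑ q ∈ Q.roots.toFinset, Polynomial.C ((Q.rootMultiplicity q + n : ℕ) : ℂ) *
        Lagrange.nodal (Q.roots.toFinset.erase q) id).eval p =
        ((Q.rootMultiplicity p + n : ℕ) : ℂ) *
          (Lagrange.nodal (Q.roots.toFinset.erase p) id).eval p := by
      rw [Polynomial.eval_finsetSum, Finset.sum_eq_single p]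
      · simp
      · intro q _ hqp
        have : (Lagrange.nodal (Q.roots.toFinset.erase q) id).eval p = 0 :=
          Lagrange.eval_nodal_at_node (v := id) (Finset.mem_erase.2 ⟨hqp.symm, hp⟩)
        simp [this]
      · exact fun h => absurd hp h
    have h0 : (Lagrange.nodal Q.roots.toFinset id).eval p = 0 :=
      Lagrange.eval_nodal_at_node (v := id) hp
    have hmult : 0 < Q.rootMultiplicity p := by
      rw [← Polynomial.count_roots]
      exact Multiset.count_pos.2 hp'
    rw [derivNumerator, Polynomial.eval_sub, Polynomial.eval_mul, Polynomial.eval_mul, hsum, h0,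
      mul_zero, zero_sub, neg_ne_zero]
    refine mul_ne_zero ih (mul_ne_zero (Nat.cast_ne_zero.2 (by omega)) ?_)
    exact eval_nodal_ne_zero (Finset.notMem_erase p _)

theorem derivNumerator_ne_zero {P Q : Polynomial ℂ} (hPQ : IsCoprime P Q) (hQ : 1 ≤ Q.natDegree)
    (n : ℕ) : derivNumerator P Q n ≠ 0 := by
  obtain ⟨p, hp⟩ := IsAlgClosed.exists_root Q
    (Polynomial.natDegree_pos_iff_degree_pos.1 hQ).ne'
  have hQ0 : Q ≠ 0 := by rintro rfl; simp at hQ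
  intro h
  refine eval_derivNumerator_root_ne_zero hPQ n (p := p) ?_ (by rw [h, Polynomial.eval_zero])
  exact Multiset.mem_toFinset.2 ((Polynomial.mem_roots hQ0).2 hp)

theorem rootMultiplicity_derivNumerator_succ {P Q : Polynomial ℂ} (hPQ : IsCoprime P Q)
    (hQ : 1 ≤ Q.natDegree) (n k : ℕ) {w : ℂ} (hw : Q.eval w ≠ 0)
    (hk : (derivNumerator P Q n).rootMultiplicity w = k + 1) :
    (derivNumerator P Q (n + 1)).rootMultiplicity w = k := by
  set A := derivNumerator P Q n with hA
  have hA0 : A ≠ 0 := derivNumerator_ne_zero hPQ hQ n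
  have hroot : A.IsRoot w := (Polynomial.rootMultiplicity_pos hA0).1 (by omega)
  have hd : (Polynomial.derivative A).rootMultiplicity w = k := by
    rw [Polynomial.derivative_rootMultiplicity_of_root hroot, hk, Nat.add_sub_cancel]
  have hd0 : Polynomial.derivative A ≠ 0 := by
    intro h
    have h1 : A = Polynomial.C (A.coeff 0) :=
      Polynomial.eq_C_of_natDegree_eq_zero (Polynomial.derivative_eq_zero.1 h)
    rw [h1, Polynomial.rootMultiplicity_C] at hk
    omega
  have hdvd : (Polynomial.X - Polynomial.C w) ^ (k + 1) ∣ A :=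
    (Polynomial.le_rootMultiplicity_iff hA0).1 hk.ge
  have hN0 := derivNumerator_ne_zero hPQ hQ (n + 1)
  refine le_antisymm ?_ ((Polynomial.le_rootMultiplicity_iff hN0).2 ?_)
  · by_contra! h
    have h1 := (Polynomial.le_rootMultiplicity_iff hN0).1 (Nat.succ_le_of_lt h)
    rw [derivNumerator, dvd_sub_left (hdvd.mul_right _)] at h1
    have hco : IsCoprime ((Polynomial.X - Polynomial.C w) ^ (k + 1))
        (Lagrange.nodal Q.roots.toFinset id) := by
      refine IsCoprime.pow_left ?_
      rw [(Polynomial.irreducible_X_sub_C w).coprime_iff_not_dvd, Polynomial.dvd_iff_isRoot]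
      exact eval_nodal_ne_zero (notMem_roots_toFinset hw)
    have h2 := (Polynomial.le_rootMultiplicity_iff hd0).2 (hco.dvd_of_dvd_mul_right h1)
    omega
  · rw [derivNumerator]
    exact dvd_sub (((Polynomial.le_rootMultiplicity_iff hd0).1 hd.ge).mul_right _)
      (((pow_dvd_pow _ (Nat.le_succ k)).trans hdvd).mul_right _)

theorem eval_derivNumerator_add {P Q : Polynomial ℂ} (hPQ : IsCoprime P Q)
    (hQ : 1 ≤ Q.natDegree) {w : ℂ} (hw : Q.eval w ≠ 0) (k : ℕ) :
    ∀ n, (derivNumerator P Q n).rootMultiplicity w = k →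
      (∀ j < k, (derivNumerator P Q (n + j)).eval w = 0) ∧
        (derivNumerator P Q (n + k)).eval w ≠ 0 := by
  induction k with
  | zero =>
    intro n hn
    refine ⟨fun j hj => absurd hj (Nat.not_lt_zero j), fun h => ?_⟩
    exact absurd ((Polynomial.rootMultiplicity_pos (derivNumerator_ne_zero hPQ hQ n)).2 h) (by omega)
  | succ k ih =>
    intro n hn
    obtain ⟨h1, h2⟩ := ih (n + 1) (rootMultiplicity_derivNumerator_succ hPQ hQ n k hw hn)
    refine ⟨fun j hj => ?_, by rwa [show n + (k + 1) = n + 1 + k by ring]⟩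
    rcases j with _ | j
    · exact (Polynomial.rootMultiplicity_pos (derivNumerator_ne_zero hPQ hQ n)).1 (by omega)
    · rw [show n + (j + 1) = n + 1 + j by ring]
      exact h1 j (by omega)

theorem iteratedDeriv_eq_zero_iff {P Q : Polynomial ℂ} {f : ℂ → ℂ}
    (hf : ∀ z : ℂ, Q.eval z ≠ 0 → f z = P.eval z / Q.eval z) (n : ℕ) {z : ℂ}
    (hz : Q.eval z ≠ 0) :
    iteratedDeriv n f z = 0 ↔ (derivNumerator P Q n).eval z = 0 := by
  have h := eval_nodal_ne_zero (notMem_roots_toFinset hz)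
  rw [iteratedDeriv_eq_derivNumerator_div hf n hz, div_eq_zero_iff]
  simp [hz, h]

theorem finsum_zeros_eq_sum_roots {P Q : Polynomial ℂ} (hPQ : IsCoprime P Q)
    (hQ : 1 ≤ Q.natDegree) {f : ℂ → ℂ}
    (hf : ∀ z : ℂ, Q.eval z ≠ 0 → f z = P.eval z / Q.eval z) (m : ℕ → ℂ → ℕ)
    (hm : ∀ n : ℕ, ∀ w : ℂ, Q.eval w ≠ 0 → iteratedDeriv n f w = 0 →
        m n w = sInf {k : ℕ | iteratedDeriv (n + k) f w ≠ 0}) (φ : ℂ → ℝ) (n : ℕ) :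
    ∑ᶠ w ∈ {w : ℂ | Q.eval w ≠ 0 ∧ iteratedDeriv n f w = 0}, (m n w : ℝ) * φ w =
      ((derivNumerator P Q n).roots.map φ).sum := by
  have hQ0 : Q ≠ 0 := by rintro rfl; simp at hQ
  have hset : {w : ℂ | Q.eval w ≠ 0 ∧ iteratedDeriv n f w = 0} =
      ((derivNumerator P Q n).roots.toFinset : Set ℂ) := by
    ext w
    simp only [mem_ofPred_eq, Finset.mem_coe, Multiset.mem_toFinset,
      Polynomial.mem_roots (derivNumerator_ne_zero hPQ hQ n), Polynomial.IsRoot.def]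
    constructor
    · rintro ⟨h1, h2⟩
      exact (iteratedDeriv_eq_zero_iff hf n h1).1 h2
    · intro h
      have hw : Q.eval w ≠ 0 := fun h0 => eval_derivNumerator_root_ne_zero hPQ n
        (Multiset.mem_toFinset.2 ((Polynomial.mem_roots hQ0).2 h0)) h
      exact ⟨hw, (iteratedDeriv_eq_zero_iff hf n hw).2 h⟩
  rw [Finset.sum_multiset_map_count, ← finsum_mem_coe_finset, ← hset]
  refine finsum_mem_congr rfl fun w hw => ?_
  obtain ⟨hw1, hw2⟩ := hw
  rw [nsmul_eq_mul, Polynomial.count_roots, hm n w hw1 hw2]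
  congr 2
  obtain ⟨h1, h2⟩ := eval_derivNumerator_add hPQ hQ hw1 _ n rfl
  have hmem : (derivNumerator P Q n).rootMultiplicity w ∈
      {k : ℕ | iteratedDeriv (n + k) f w ≠ 0} :=
    fun h => h2 ((iteratedDeriv_eq_zero_iff hf _ hw1).1 h)
  refine le_antisymm (Nat.sInf_le hmem) (le_csInf ⟨_, hmem⟩ fun k hk => ?_)
  by_contra! h
  exact hk ((iteratedDeriv_eq_zero_iff hf _ hw1).2 (h1 k h))

theorem tendsto_prod_sub_div_atTop_zero {m j : ℕ} (hm : 1 ≤ m) (hj : 1 ≤ j) :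
    Tendsto (fun n : ℕ => ∏ i ∈ Finset.range n, (((j : ℂ) - m - i) / (-(m : ℂ) - i)))
      atTop (𝓝 0) := by
  have hm1 : (1 : ℝ) ≤ m := by exact_mod_cast hm
  rcases le_or_gt j m with hjm | hjm
  · have hbound : ∀ n : ℕ, ‖∏ i ∈ Finset.range n, (((j : ℂ) - m - i) / (-(m : ℂ) - i))‖ ≤
        (m : ℝ) / (m + n : ℝ) := by
      intro n
      induction n with
      | zero => simp; rw [div_self (by linarith)]
      | succ n ih =>
        have hn : (0 : ℝ) ≤ n := n.cast_nonneg
        have hj1 : (1 : ℝ) ≤ j := by exact_mod_cast hj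
        have hjm' : (j : ℝ) ≤ m := by exact_mod_cast hjm
        have hfac : ‖((j : ℂ) - m - n) / (-(m : ℂ) - n)‖ ≤ ((m : ℝ) + n) / (m + n + 1) := by
          have h1 : ((j : ℂ) - m - n) / (-(m : ℂ) - n) =
              ((((m : ℝ) + n - j) / (m + n) : ℝ) : ℂ) := by
            push_cast
            rw [← neg_div_neg_eq]
            congr 1 <;> ring
          rw [h1, Complex.norm_of_nonneg (div_nonneg (by linarith) (by linarith)),
            div_le_div_iff₀ (by linarith) (by linarith)]
          nlinarith
        rw [Finset.prod_range_succ, norm_mul]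
        refine (mul_le_mul ih hfac (norm_nonneg _) (by positivity)).trans_eq ?_
        push_cast
        field_simp
        ring
    refine squeeze_zero_norm hbound ?_
    refine tendsto_const_nhds.div_atTop ?_
    exact tendsto_atTop_add_const_left _ _ tendsto_natCast_atTop_atTop
  · refine tendsto_const_nhds.congr' ?_
    filter_upwards [eventually_gt_atTop (j - m)] with n hn
    refine (Finset.prod_eq_zero (Finset.mem_range.2 hn) ?_).symm
    rw [Nat.cast_sub hjm.le]
    simp

theorem factorial_le_norm_prod {m : ℕ} (hm : 1 ≤ m) (n : ℕ) :
    (n.factorial : ℝ) ≤ ‖∏ i ∈ Finset.range n, (-(m : ℂ) - i)‖ := by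
  induction n with
  | zero => simp
  | succ n ih =>
    have h : ‖-(m : ℂ) - n‖ = (m + n : ℝ) := by
      rw [show -(m : ℂ) - n = -((m + n : ℝ) : ℂ) by push_cast; ring, norm_neg,
        Complex.norm_of_nonneg (by positivity)]
    have hm1 : (1 : ℝ) ≤ m := by exact_mod_cast hm
    rw [Finset.prod_range_succ, norm_mul, h, Nat.factorial_succ]
    push_cast
    nlinarith [mul_le_mul ih (show (n + 1 : ℝ) ≤ m + n by linarith) (by positivity)
      (norm_nonneg _)]

theorem iteratedDeriv_sub_zpow (p z : ℂ) (k : ℤ) (n : ℕ) :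
    iteratedDeriv n (fun w : ℂ => (w - p) ^ k) z =
      (∏ i ∈ Finset.range n, ((k : ℂ) - i)) * (z - p) ^ (k - n) := by
  rw [iteratedDeriv_comp_sub_const n (fun w : ℂ => w ^ k) p, iteratedDeriv_eq_iterate]
  exact iter_deriv_zpow k (z - p) n

theorem contDiffAt_sub_zpow {p z : ℂ} (h : z ≠ p) (k : ℤ) (n : ℕ) :
    ContDiffAt ℂ n (fun w : ℂ => (w - p) ^ k) z :=
  AnalyticAt.contDiffAt (by
    have : AnalyticAt ℂ (fun w : ℂ => w - p) z := by fun_prop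
    exact this.zpow (sub_ne_zero.2 h))

theorem exists_partialFraction {P Q : Polynomial ℂ} (hPQ : IsCoprime P Q) (hQ0 : Q ≠ 0) {p : ℂ}
    (hp : Q.IsRoot p) : ∃ (m : ℕ) (U V Q₁ : Polynomial ℂ), 1 ≤ m ∧ U.eval p ≠ 0 ∧
      Q₁.eval p ≠ 0 ∧ Q = (Polynomial.X - Polynomial.C p) ^ m * Q₁ ∧
      P = V * (Polynomial.X - Polynomial.C p) ^ m + U * Q₁ := by
  obtain ⟨Q₁, hQ₁, hndvd⟩ := Polynomial.exists_eq_pow_rootMultiplicity_mul_and_not_dvd Q hQ0 p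
  rw [Polynomial.dvd_iff_isRoot] at hndvd
  have hco : IsCoprime ((Polynomial.X - Polynomial.C p) ^ Q.rootMultiplicity p) Q₁ := by
    refine IsCoprime.pow_left ?_
    rw [(Polynomial.irreducible_X_sub_C p).coprime_iff_not_dvd, Polynomial.dvd_iff_isRoot]
    exact hndvd
  have hm : 1 ≤ Q.rootMultiplicity p := (Polynomial.rootMultiplicity_pos hQ0).2 hp
  obtain ⟨a, b, hab⟩ := hco
  refine ⟨_, P * b, P * a, Q₁, hm, ?_, hndvd, hQ₁, ?_⟩
  · have h1 : b.eval p ≠ 0 := by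
      intro h
      have := congrArg (Polynomial.eval p) hab
      simp [h, (Nat.one_le_iff_ne_zero.1 hm)] at this
    have h2 : P.eval p ≠ 0 := by
      intro h
      obtain ⟨c, d, hcd⟩ := hPQ
      have := congrArg (Polynomial.eval p) hcd
      simp [h, hp.eq_zero] at this
    rw [Polynomial.eval_mul]
    exact mul_ne_zero h2 h1
  · linear_combination (-P) * hab

theorem exists_radius_between (S : Finset ℂ) {z : ℂ} {d : ℝ} (h : ∀ q ∈ S, d < dist z q) :
    ∃ r, d < r ∧ ∀ q ∈ S, r < dist z q := by
  have h1 : ∀ᶠ r in 𝓝[>] d, ∀ q ∈ S, r < dist z q :=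
    (Finset.eventually_all S).2 fun q hq =>
      eventually_nhdsWithin_of_eventually_nhds (eventually_lt_nhds (h q hq))
  obtain ⟨r, hr1, hr2⟩ := (h1.and self_mem_nhdsWithin).exists
  exact ⟨r, hr2, hr1⟩

/-- The `n`-th derivative of `P / Q` at a point whose unique nearest pole is `p` is asymptotic to
that of `(z - p) ^ (-m)`, up to a nonzero constant. -/
theorem tendsto_iteratedDeriv_div_nearest {P Q : Polynomial ℂ} (hPQ : IsCoprime P Q) (hQ0 : Q ≠ 0)
    {f : ℂ → ℂ} (hf : ∀ z : ℂ, Q.eval z ≠ 0 → f z = P.eval z / Q.eval z) {p z : ℂ}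
    (hp : Q.IsRoot p) (hz : Q.eval z ≠ 0)
    (hnear : ∀ q ∈ Q.roots.toFinset, q ≠ p → dist z p < dist z q) :
    ∃ (m : ℕ) (c : ℂ), 1 ≤ m ∧ c ≠ 0 ∧ Tendsto (fun n : ℕ => iteratedDeriv n f z /
      ((∏ i ∈ Finset.range n, (-(m : ℂ) - i)) * (z - p) ^ (-(m : ℤ) - n))) atTop (𝓝 c) := by
  obtain ⟨m, U, V, Q₁, hm, hU, hQ₁p, hQ, hP⟩ := exists_partialFraction hPQ hQ0 hp
  have hzp : z ≠ p := by rintro rfl; exact hz hp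
  have hzp' : z - p ≠ 0 := sub_ne_zero.2 hzp
  obtain ⟨r, hdr, hr⟩ := exists_radius_between (Q.roots.toFinset.erase p) (z := z) (d := dist z p)
    (fun q hq => hnear q (Finset.mem_of_mem_erase hq) (Finset.ne_of_mem_erase hq))
  have hr0 : 0 < r := dist_nonneg.trans_lt hdr
  have hQ₁ : ∀ w ∈ closedBall z r, Q₁.eval w ≠ 0 := by
    intro w hw h
    have hwp : w ≠ p := by rintro rfl; exact hQ₁p h
    have hwQ : w ∈ Q.roots.toFinset.erase p := by
      refine Finset.mem_erase.2 ⟨hwp, Multiset.mem_toFinset.2 ((Polynomial.mem_roots hQ0).2 ?_)⟩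
      rw [Polynomial.IsRoot.def, hQ, Polynomial.eval_mul, h, mul_zero]
    have := hr w hwQ
    rw [mem_closedBall, dist_comm] at hw
    linarith
  set G : ℂ → ℂ := fun w => V.eval w / Q₁.eval w with hG
  have hGd : DifferentiableOn ℂ G (closedBall z r) := fun w hw =>
    (V.differentiable.differentiableAt.fun_div Q₁.differentiable.differentiableAt
      (hQ₁ w hw)).differentiableWithinAt
  obtain ⟨C, hC⟩ := (isCompact_closedBall z r).exists_bound_of_continuousOn hGd.continuousOn
  have hGn : ∀ n : ℕ, ‖iteratedDeriv n G z‖ ≤ n.factorial * C / r ^ n := fun n =>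
    norm_iteratedDeriv_le_of_forall_mem_sphere_norm_le n hr0
      (hGd.diffContOnCl_ball subset_rfl) fun w hw => hC w (sphere_subset_closedBall hw)
  have hC0 : 0 ≤ C := (norm_nonneg _).trans (hC z (mem_closedBall_self hr0.le))
  have hGc : ∀ n : ℕ, ContDiffAt ℂ n G z := fun n =>
    (hGd.analyticAt (closedBall_mem_nhds z hr0)).contDiffAt
  set T := Polynomial.taylor p U with hT
  set N := T.natDegree + 1
  have hUsum : ∀ w, U.eval w = ∑ j ∈ Finset.range N, T.coeff j * (w - p) ^ j := by
    intro w
    have : U.eval w = T.eval (w - p) := by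
      rw [hT, Polynomial.taylor_eval]
      simp
    rw [this, Polynomial.eval_eq_sum_range]
  have hfev : f =ᶠ[𝓝 z] fun w =>
      (∑ j ∈ Finset.range N, T.coeff j * (w - p) ^ ((j : ℤ) - m)) + G w := by
    filter_upwards [Q.continuous.continuousAt.eventually_ne hz] with w hw
    have hw' := hw
    rw [hQ, Polynomial.eval_mul, mul_ne_zero_iff] at hw'
    obtain ⟨hw1, hw2⟩ := hw'
    have hwp : w - p ≠ 0 := by
      intro h
      apply hw1
      simp [h, Nat.one_le_iff_ne_zero.1 hm]
    have hsum : ∑ j ∈ Finset.range N, T.coeff j * (w - p) ^ ((j : ℤ) - m) =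
        U.eval w / (w - p) ^ m := by
      rw [hUsum, Finset.sum_div]
      refine Finset.sum_congr rfl fun j _ => ?_
      rw [zpow_sub₀ hwp, zpow_natCast, zpow_natCast, mul_div_assoc]
    rw [hf w hw, hsum, hG, hP, hQ]
    simp only [Polynomial.eval_add, Polynomial.eval_mul, Polynomial.eval_pow, Polynomial.eval_sub,
      Polynomial.eval_X, Polynomial.eval_C]
    field_simp
    ring
  have hfn : ∀ n : ℕ, iteratedDeriv n f z = (∑ j ∈ Finset.range N, T.coeff j *
      ((∏ i ∈ Finset.range n, ((j : ℂ) - m - i)) * (z - p) ^ ((j : ℤ) - m - n))) +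
        iteratedDeriv n G z := by
    intro n
    have hterm : ∀ j ∈ Finset.range N,
        ContDiffAt ℂ n (fun w : ℂ => T.coeff j * (w - p) ^ ((j : ℤ) - m)) z :=
      fun j _ => contDiffAt_const.mul (contDiffAt_sub_zpow hzp _ n)
    rw [hfev.iteratedDeriv_eq n, iteratedDeriv_fun_add (ContDiffAt.sum hterm) (hGc n),
      iteratedDeriv_fun_sum hterm]
    congr 1
    refine Finset.sum_congr rfl fun j _ => ?_
    rw [iteratedDeriv_const_mul_field, iteratedDeriv_sub_zpow]
    push_cast
    rfl
  have hprod : ∀ n : ℕ, (∏ i ∈ Finset.range n, (-(m : ℂ) - i)) ≠ 0 := fun n => by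
    rw [← norm_pos_iff]
    exact lt_of_lt_of_le (by exact_mod_cast n.factorial_pos) (factorial_le_norm_prod hm n)
  refine ⟨m, T.coeff 0, hm, ?_, ?_⟩
  · rw [hT, Polynomial.taylor_coeff_zero]
    exact hU
  have hlim : Tendsto (fun n : ℕ => (∑ j ∈ Finset.range N, T.coeff j * (z - p) ^ j *
      ∏ i ∈ Finset.range n, (((j : ℂ) - m - i) / (-(m : ℂ) - i))) +
      iteratedDeriv n G z / ((∏ i ∈ Finset.range n, (-(m : ℂ) - i)) * (z - p) ^ (-(m : ℤ) - n)))
      atTop (𝓝 ((∑ j ∈ Finset.range N, if j = 0 then T.coeff 0 else 0) + 0)) := by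
    refine Tendsto.add (tendsto_finsetSum _ fun j _ => ?_) ?_
    · split_ifs with hj
      · subst hj
        refine tendsto_const_nhds.congr fun n => ?_
        rw [Finset.prod_eq_one]
        · simp
        · intro i _
          have : -(m : ℂ) - i ≠ 0 := by
            rw [show -(m : ℂ) - i = -((m + i : ℕ) : ℂ) by push_cast; ring]
            exact neg_ne_zero.2 (Nat.cast_ne_zero.2 (by omega))
          rw [Nat.cast_zero, zero_sub, div_self this]
      · simpa using (tendsto_prod_sub_div_atTop_zero hm (Nat.one_le_iff_ne_zero.2 hj)).const_mul
          (T.coeff j * (z - p) ^ j)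
    · have hgeo : Tendsto (fun n : ℕ => C * dist z p ^ m * (dist z p / r) ^ n) atTop (𝓝 0) := by
        simpa using (tendsto_pow_atTop_nhds_zero_of_lt_one (by positivity)
          ((div_lt_one hr0).2 hdr)).const_mul (C * dist z p ^ m)
      refine squeeze_zero_norm (fun n => ?_) hgeo
      have hd0 : 0 < dist z p := dist_pos.2 hzp
      have hz1 : ‖(z - p) ^ (-(m : ℤ) - n)‖ = (dist z p ^ m * dist z p ^ n)⁻¹ := by
        rw [norm_zpow, ← dist_eq_norm, ← pow_add, ← zpow_natCast, ← zpow_neg]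
        congr 1
        push_cast
        ring
      rw [norm_div, norm_mul, hz1, div_pow]
      have hf0 : (0 : ℝ) < n.factorial := by exact_mod_cast n.factorial_pos
      calc _ ≤ (n.factorial * C / r ^ n) / (n.factorial * (dist z p ^ m * dist z p ^ n)⁻¹) := by
            refine div_le_div₀ (by positivity) (hGn n) (by positivity) ?_
            gcongr
            exact factorial_le_norm_prod hm n
        _ = _ := by field_simp
  have hval : (∑ j ∈ Finset.range N, if j = 0 then T.coeff 0 else 0) + 0 = T.coeff 0 := by
    rw [add_zero, Finset.sum_ite_eq' (Finset.range N) 0, if_pos (Finset.mem_range.2 (by omega))]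
  rw [hval] at hlim
  refine hlim.congr fun n => ?_
  rw [hfn, add_div, Finset.sum_div]
  congr 1
  refine Finset.sum_congr rfl fun j _ => ?_
  rw [Finset.prod_div_distrib, show (j : ℤ) - m - n = j + (-(m : ℤ) - n) by ring,
    zpow_add₀ hzp', zpow_natCast]
  have := zpow_ne_zero (-(m : ℤ) - n) hzp'
  have := hprod n
  field_simp

theorem tendsto_iteratedDeriv_ratio {P Q : Polynomial ℂ} (hPQ : IsCoprime P Q) (hQ0 : Q ≠ 0)
    {f : ℂ → ℂ} (hf : ∀ z : ℂ, Q.eval z ≠ 0 → f z = P.eval z / Q.eval z) {p z : ℂ}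
    (hp : Q.IsRoot p) (hz : Q.eval z ≠ 0)
    (hnear : ∀ q ∈ Q.roots.toFinset, q ≠ p → dist z p < dist z q) :
    (∀ᶠ n in atTop, iteratedDeriv n f z ≠ 0) ∧
    Tendsto (fun n : ℕ => iteratedDeriv (n + 1) f z / (n * iteratedDeriv n f z)) atTop
      (𝓝 (-(1 / (z - p)))) := by
  obtain ⟨m, c, hm, hc, hlim⟩ := tendsto_iteratedDeriv_div_nearest hPQ hQ0 hf hp hz hnear
  have hne : ∀ᶠ n in atTop, iteratedDeriv n f z ≠ 0 := by
    filter_upwards [hlim.eventually_ne hc] with n hn h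
    exact hn (by rw [h, zero_div])
  refine ⟨hne, ?_⟩
  have hzp : z - p ≠ 0 := by
    rw [sub_ne_zero]
    rintro rfl
    exact hz hp
  have h1 : Tendsto (fun n : ℕ => (-(m : ℂ) / n + -1) * (1 / (z - p))) atTop
      (𝓝 ((0 + -1) * (1 / (z - p)))) :=
    ((tendsto_const_div_atTop_nhds_zero_nat _).add_const _).mul_const _
  have h2 := (((hlim.comp (tendsto_add_atTop_nat 1)).div hlim hc).mul h1)
  rw [div_self hc, one_mul, zero_add, neg_one_mul] at h2
  refine h2.congr' ?_
  filter_upwards [hne, eventually_gt_atTop 0] with n hn hn0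
  have hprod : (∏ i ∈ Finset.range n, (-(m : ℂ) - i)) ≠ 0 := by
    rw [← norm_pos_iff]
    exact lt_of_lt_of_le (by exact_mod_cast n.factorial_pos) (factorial_le_norm_prod hm n)
  have hmn : -(m : ℂ) - n ≠ 0 := by
    rw [show -(m : ℂ) - n = -((m + n : ℕ) : ℂ) by push_cast; ring]
    exact neg_ne_zero.2 (Nat.cast_ne_zero.2 (by omega))
  have hz0 := zpow_ne_zero (-(m : ℤ) - n) hzp
  have hn' : (n : ℂ) ≠ 0 := Nat.cast_ne_zero.2 hn0.ne'
  simp only [Pi.div_apply, Function.comp_apply, Finset.prod_range_succ]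
  rw [show -(m : ℤ) - ((n + 1 : ℕ) : ℤ) = (-(m : ℤ) - n) - 1 by push_cast; ring,
    zpow_sub_one₀ hzp]
  field_simp
  ring

theorem tendsto_logDeriv_derivNumerator {P Q : Polynomial ℂ} (hPQ : IsCoprime P Q) (hQ0 : Q ≠ 0)
    {f : ℂ → ℂ} (hf : ∀ z : ℂ, Q.eval z ≠ 0 → f z = P.eval z / Q.eval z) {p z : ℂ}
    (hp : Q.IsRoot p) (hz : Q.eval z ≠ 0)
    (hnear : ∀ q ∈ Q.roots.toFinset, q ≠ p → dist z p < dist z q) :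
    Tendsto (fun n : ℕ => ((derivNumerator P Q n).roots.map fun w => 1 / (z - w)).sum / n) atTop
      (𝓝 (∑ q ∈ Q.roots.toFinset, 1 / (z - q) - 1 / (z - p))) := by
  obtain ⟨hne, hlim⟩ := tendsto_iteratedDeriv_ratio hPQ hQ0 hf hp hz hnear
  have h1 := (hlim.add (tendsto_const_div_atTop_nhds_zero_nat
    (∑ p ∈ Q.roots.toFinset, (Q.rootMultiplicity p : ℂ) / (z - p)))).add_const
      (∑ q ∈ Q.roots.toFinset, 1 / (z - q))
  rw [add_zero, neg_add_eq_sub] at h1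
  refine h1.congr' ?_
  filter_upwards [hne, eventually_gt_atTop 0] with n hn hn0
  have hA : (derivNumerator P Q n).eval z ≠ 0 := fun h =>
    hn ((iteratedDeriv_eq_zero_iff hf n hz).2 h)
  have hR := eval_nodal_ne_zero (notMem_roots_toFinset hz)
  have hn' : (n : ℂ) ≠ 0 := Nat.cast_ne_zero.2 hn0.ne'
  rw [← (IsAlgClosed.splits _).eval_derivative_div_eval_of_ne_zero hA,
    iteratedDeriv_eq_derivNumerator_div hf n hz, iteratedDeriv_eq_derivNumerator_div hf (n + 1) hz,
    eval_derivNumerator_succ n hz, pow_succ]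
  field_simp
  ring

/-- The unit vector in direction `θ`. -/
noncomputable def unitDir (θ : ℝ) : ℂ := Real.cos θ + Real.sin θ * I

theorem continuous_unitDir : Continuous unitDir := by
  unfold unitDir
  fun_prop

theorem norm_unitDir (θ : ℝ) : ‖unitDir θ‖ = 1 := by
  rw [unitDir, ofReal_cos, ofReal_sin, ← Complex.exp_mul_I, Complex.norm_exp_ofReal_mul_I]

theorem inv_conj_mul_unitDir {r : ℝ} (θ : ℝ) :
    (starRingEnd ℂ (r * unitDir θ))⁻¹ = (r⁻¹ : ℝ) * unitDir θ := by
  have h : unitDir θ * starRingEnd ℂ (unitDir θ) = 1 := by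
    rw [Complex.mul_conj, Complex.normSq_eq_norm_sq, norm_unitDir]
    norm_num
  rw [map_mul, mul_inv, conj_ofReal, ofReal_inv, inv_eq_of_mul_eq_one_left h]

/-- The points at least as close to `p` as to every point of `T`. -/
def nearCell (p : ℂ) (T : Finset ℂ) : Set ℂ := {z | ∀ q ∈ T, dist z p ≤ dist z q}

/-- The inverse of the distance from `p`, in direction `θ`, to the bisector of `p` and `q`
(nonpositive if the ray does not meet the bisector). -/
noncomputable def bisectorCurv (p q : ℂ) (θ : ℝ) : ℝ := 2 * (unitDir θ / (q - p)).re

theorem continuous_bisectorCurv (p q : ℂ) : Continuous (bisectorCurv p q) := by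
  unfold bisectorCurv
  have := continuous_unitDir
  fun_prop

theorem dist_add_mul_unitDir_sub {p q : ℂ} (hpq : q ≠ p) (r θ : ℝ) :
    dist (p + r * unitDir θ) q ^ 2 - dist (p + r * unitDir θ) p ^ 2 =
      dist p q ^ 2 * (1 - r * bisectorCurv p q θ) := by
  have hd : q - p ≠ 0 := sub_ne_zero.2 hpq
  obtain ⟨d, rfl⟩ : ∃ d, q = p + d := ⟨q - p, by ring⟩
  rw [add_sub_cancel_left] at hd
  have hd' : normSq d ≠ 0 := by simpa using hd
  simp only [dist_eq_norm, ← Complex.normSq_eq_norm_sq, bisectorCurv, add_sub_cancel_left,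
    Complex.div_re]
  rw [show p + r * unitDir θ - (p + d) = r * unitDir θ - d by ring,
    show p - (p + d) = -d by ring, normSq_neg]
  field_simp
  simp only [normSq_apply, sub_re, sub_im, mul_re, mul_im, ofReal_re, ofReal_im]
  ring

theorem add_mul_unitDir_mem_nearCell_iff {p : ℂ} {T : Finset ℂ} (hp : p ∉ T) (r θ : ℝ) :
    p + r * unitDir θ ∈ nearCell p T ↔ ∀ q ∈ T, r * bisectorCurv p q θ ≤ 1 := by
  refine forall₂_congr fun q hq => ?_
  have hqp : q ≠ p := fun h => hp (h ▸ hq)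
  have h := dist_add_mul_unitDir_sub hqp r θ
  have hpos : 0 < dist p q ^ 2 := by have := dist_pos.2 hqp.symm; positivity
  rw [← sq_le_sq₀ dist_nonneg dist_nonneg, ← sub_nonneg, h, mul_nonneg_iff_of_pos_left hpos,
    sub_nonneg]

theorem isClosed_nearCell (p : ℂ) (T : Finset ℂ) : IsClosed (nearCell p T) := by
  have : nearCell p T = ⋂ q ∈ T, {z | dist z p ≤ dist z q} := by
    ext z
    simp [nearCell]
  rw [this]
  exact isClosed_biInter fun q _ => isClosed_le (by fun_prop) (by fun_prop)

theorem ae_injOn_bisectorCurv (p : ℂ) (T : Finset ℂ) :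
    ∀ᵐ θ : ℝ, Set.InjOn (fun q => bisectorCurv p q θ) T := by
  have hzero : ∀ a : ℂ, a ≠ 0 → ∀ᵐ θ : ℝ, (unitDir θ * a).re ≠ 0 := by
    intro a ha
    have hsub : {θ : ℝ | ¬ (unitDir θ * a).re ≠ 0} ⊆
        range fun k : ℤ => (2 * k + 1) * Real.pi / 2 - arg a := by
      intro θ hθ
      simp only [ne_eq, not_not, mem_ofPred_eq] at hθ
      have h1 : (unitDir θ * a).re = ‖a‖ * Real.cos (θ + arg a) := by
        rw [Real.cos_add, unitDir]
        simp only [mul_re, add_re, add_im, mul_im, ofReal_re, ofReal_im, I_re, I_im]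
        have h2 := Complex.norm_mul_cos_arg a
        have h3 := Complex.norm_mul_sin_arg a
        linear_combination (-Real.cos θ) * h2 + Real.sin θ * h3
      rw [h1, mul_eq_zero, norm_eq_zero, or_iff_right ha, Real.cos_eq_zero_iff] at hθ
      obtain ⟨k, hk⟩ := hθ
      exact ⟨k, by simp only; linarith⟩
    exact ((countable_range _).mono hsub).measure_zero _
  have hpair : ∀ q ∈ T, ∀ q' ∈ T, ∀ᵐ θ : ℝ, bisectorCurv p q θ = bisectorCurv p q' θ → q = q' := by
    intro q _ q' _
    rcases eq_or_ne q q' with h | h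
    · exact ae_of_all _ fun _ _ => h
    · have ha : (q - p)⁻¹ - (q' - p)⁻¹ ≠ 0 := by
        rw [sub_ne_zero]
        intro h'
        exact h (by simpa using inv_injective h')
      filter_upwards [hzero _ ha] with θ hθ h'
      refine absurd ?_ hθ
      rw [mul_sub, sub_re]
      simp only [bisectorCurv, div_eq_mul_inv] at h'
      linarith
  have hall := (Finset.eventually_all T).2 fun q hq =>
    (Finset.eventually_all T).2 fun q' hq' => hpair q hq q' hq'
  filter_upwards [hall] with θ hθ q hq q' hq' h using hθ q hq q' hq' h

theorem integral_Ioi_indicator_deriv {ι : Type*} {h : ℝ → ℝ} (hh : ContDiff ℝ 1 h)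
    (hs : HasCompactSupport h) (T : Finset ι) (c : ι → ℝ) (hc : Set.InjOn c T) :
    ∫ r in Ioi 0, {r : ℝ | ∀ q ∈ T, r * c q ≤ 1}.indicator (deriv h) r =
      -h 0 + ∑ q ∈ T, if 0 < c q ∧ ∀ q' ∈ T, c q' ≤ c q then h (c q)⁻¹ else 0 := by
  classical
  by_cases hpos : ∃ q ∈ T, 0 < c q
  · obtain ⟨q₁, hq₁, hq₁pos⟩ := hpos
    obtain ⟨q₀, hq₀, hmax⟩ := T.exists_max_image c ⟨q₁, hq₁⟩
    have hq₀pos : 0 < c q₀ := hq₁pos.trans_le (hmax q₁ hq₁)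
    have hsum : (∑ q ∈ T, if 0 < c q ∧ ∀ q' ∈ T, c q' ≤ c q then h (c q)⁻¹ else 0) =
        h (c q₀)⁻¹ := by
      rw [Finset.sum_eq_single_of_mem q₀ hq₀, if_pos ⟨hq₀pos, hmax⟩]
      intro q hq hne
      rw [if_neg]
      rintro ⟨-, h2⟩
      exact hne (hc hq hq₀ (le_antisymm (hmax q hq) (h2 q₀ hq₀)))
    have hset : EqOn ({r : ℝ | ∀ q ∈ T, r * c q ≤ 1}.indicator (deriv h))
        ((Iic (c q₀)⁻¹).indicator (deriv h)) (Ioi 0) := by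
      intro r hr
      have hr : 0 < r := hr
      have hiff : r ∈ {r : ℝ | ∀ q ∈ T, r * c q ≤ 1} ↔ r ∈ Iic (c q₀)⁻¹ := by
        simp only [mem_ofPred_eq, mem_Iic]
        rw [inv_eq_one_div, le_div_iff₀ hq₀pos]
        constructor
        · intro h1
          exact h1 q₀ hq₀
        · intro h1 q hq
          exact (mul_le_mul_of_nonneg_left (hmax q hq) hr.le).trans h1
      by_cases hr' : r ∈ Iic (c q₀)⁻¹
      · rw [indicator_of_mem hr', indicator_of_mem (hiff.2 hr')]
      · rw [indicator_of_notMem hr', indicator_of_notMem (hiff.not.2 hr')]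
    rw [setIntegral_congr_fun measurableSet_Ioi hset, setIntegral_indicator measurableSet_Iic,
      Ioi_inter_Iic, hsum, ← intervalIntegral.integral_of_le (inv_nonneg.2 hq₀pos.le),
      intervalIntegral.integral_deriv_eq_sub
        (fun x _ => (hh.differentiable one_ne_zero).differentiableAt)
        ((hh.continuous_deriv le_rfl).intervalIntegrable _ _)]
    ring
  · push Not at hpos
    have hset : EqOn ({r : ℝ | ∀ q ∈ T, r * c q ≤ 1}.indicator (deriv h)) (deriv h) (Ioi 0) := by
      intro r hr
      have hr : 0 < r := hr
      refine indicator_of_mem (fun q hq => ?_) _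
      exact (mul_nonpos_of_nonneg_of_nonpos hr.le (hpos q hq)).trans zero_le_one
    rw [setIntegral_congr_fun measurableSet_Ioi hset, hs.integral_Ioi_deriv_eq hh,
      Finset.sum_eq_zero, add_zero]
    intro q hq
    rw [if_neg]
    rintro ⟨h1, -⟩
    exact (hpos q hq).not_gt h1

/-- The pairing `∇φ(z) · ∇ log |z - w|`. -/
noncomputable def gradLogPairing (φ : ℂ → ℝ) (w z : ℂ) : ℝ :=
  fderiv ℝ φ z (starRingEnd ℂ (z - w))⁻¹

/-- The radial derivative of `φ` at the point with polar coordinates `x` around `p`. -/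
noncomputable def radialDeriv (φ : ℂ → ℝ) (p : ℂ) (x : ℝ × ℝ) : ℝ :=
  fderiv ℝ φ (p + x.1 * unitDir x.2) (unitDir x.2)

theorem continuous_radialDeriv {φ : ℂ → ℝ} (hφ : ContDiff ℝ 1 φ) (p : ℂ) :
    Continuous (radialDeriv φ p) := by
  have h1 := hφ.continuous_fderiv one_ne_zero
  have h2 := continuous_unitDir
  unfold radialDeriv
  fun_prop

theorem hasDerivAt_comp_ray {φ : ℂ → ℝ} (hφ : ContDiff ℝ 1 φ) (p : ℂ) (r θ : ℝ) :
    HasDerivAt (fun r : ℝ => φ (p + r * unitDir θ)) (radialDeriv φ p (r, θ)) r := by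
  have h1 : HasDerivAt (fun r : ℝ => p + (r : ℂ) * unitDir θ) (unitDir θ) r := by
    simpa using (((hasDerivAt_id r).ofReal_comp).mul_const (unitDir θ)).const_add p
  exact ((hφ.differentiable one_ne_zero) _).hasFDerivAt.comp_hasDerivAt r h1

theorem contDiff_comp_ray {φ : ℂ → ℝ} (hφ : ContDiff ℝ 1 φ) (p : ℂ) (θ : ℝ) :
    ContDiff ℝ 1 fun r : ℝ => φ (p + r * unitDir θ) := by
  have : ContDiff ℝ 1 fun r : ℝ => p + (r : ℂ) * unitDir θ :=
    contDiff_const.add (ofRealCLM.contDiff.mul contDiff_const)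
  exact hφ.comp this

theorem hasCompactSupport_comp_ray {φ : ℂ → ℝ} (hφ : HasCompactSupport φ) (p : ℂ) (θ : ℝ) :
    HasCompactSupport fun r : ℝ => φ (p + r * unitDir θ) := by
  refine hφ.comp_isClosedEmbedding (g := fun r : ℝ => p + (r : ℂ) * unitDir θ) ?_
  refine Isometry.isClosedEmbedding (Isometry.of_dist_eq fun r s => ?_)
  rw [dist_add_left, dist_eq_norm, ← sub_mul, norm_mul, norm_unitDir, mul_one, ← ofReal_sub,
    norm_real, dist_eq_norm]

theorem integrableOn_indicator_radialDeriv {φ : ℂ → ℝ} (hφ : ContDiff ℝ 1 φ)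
    (hs : HasCompactSupport φ) (p : ℂ) {V : Set ℂ} (hV : MeasurableSet V) :
    IntegrableOn (((fun x : ℝ × ℝ => p + x.1 * unitDir x.2) ⁻¹' V).indicator (radialDeriv φ p))
      (Ioi 0 ×ˢ Ioo (-Real.pi) Real.pi) := by
  have hpolar : Continuous fun x : ℝ × ℝ => p + x.1 * unitDir x.2 := by
    have := continuous_unitDir
    fun_prop
  obtain ⟨R, hR⟩ := (hs.isCompact.isBounded).subset_closedBall p
  have hK : IntegrableOn (radialDeriv φ p) (Icc 0 R ×ˢ Icc (-Real.pi) Real.pi) :=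
    ((continuous_radialDeriv hφ p).continuousOn).integrableOn_compact
      (isCompact_Icc.prod isCompact_Icc)
  refine (hK.of_forall_sdiff_eq_zero (t := Ioi 0 ×ˢ Ioo (-Real.pi) Real.pi)
    (measurableSet_Ioi.prod measurableSet_Ioo) ?_).indicator (hpolar.measurable hV)
  rintro ⟨r, θ⟩ ⟨⟨hr, hθ⟩, hx⟩
  have hr : 0 < r := hr
  have hrR : R < r := by
    by_contra! h
    exact hx ⟨⟨hr.le, h⟩, Ioo_subset_Icc_self hθ⟩
  have hout : p + r * unitDir θ ∉ tsupport (fderiv ℝ φ) := by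
    intro h
    have := hR (tsupport_fderiv_subset ℝ h)
    rw [mem_closedBall, dist_self_add_left, norm_mul, norm_unitDir, mul_one, norm_real,
      Real.norm_of_nonneg hr.le] at this
    linarith
  simp [radialDeriv, image_eq_zero_of_notMem_tsupport hout]

theorem setIntegral_gradLogPairing {φ : ℂ → ℝ} (hφ : ContDiff ℝ 1 φ) (hs : HasCompactSupport φ)
    (p : ℂ) {V : Set ℂ} (hV : MeasurableSet V) :
    ∫ z in V, gradLogPairing φ p z = ∫ θ in Ioo (-Real.pi) Real.pi, ∫ r in Ioi 0,
      ((fun x : ℝ × ℝ => p + x.1 * unitDir x.2) ⁻¹' V).indicator (radialDeriv φ p) (r, θ) := by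
  rw [← integral_indicator hV, ← integral_add_left_eq_self _ p,
    ← Complex.integral_comp_polarCoord_symm, polarCoord_target]
  have hcongr : EqOn (fun x : ℝ × ℝ =>
      x.1 • V.indicator (gradLogPairing φ p) (p + Complex.polarCoord.symm x))
      (((fun x : ℝ × ℝ => p + x.1 * unitDir x.2) ⁻¹' V).indicator (radialDeriv φ p))
      (Ioi 0 ×ˢ Ioo (-Real.pi) Real.pi) := by
    rintro ⟨r, θ⟩ ⟨hr, -⟩
    have hr : 0 < r := hr
    have hsymm : Complex.polarCoord.symm (r, θ) = r * unitDir θ :=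
      Complex.polarCoord_symm_apply _
    simp only [hsymm]
    by_cases h : p + r * unitDir θ ∈ V
    · rw [indicator_of_mem h, indicator_of_mem (show (r, θ) ∈
        (fun x : ℝ × ℝ => p + x.1 * unitDir x.2) ⁻¹' V from h), gradLogPairing,
        add_sub_cancel_left, inv_conj_mul_unitDir, ← Complex.real_smul (x := r⁻¹), map_smul,
        smul_smul, mul_inv_cancel₀ hr.ne', one_smul, radialDeriv]
    · rw [indicator_of_notMem h, indicator_of_notMem (show (r, θ) ∉
        (fun x : ℝ × ℝ => p + x.1 * unitDir x.2) ⁻¹' V from h), smul_zero]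
  have hint := integrableOn_indicator_radialDeriv hφ hs p hV
  rw [setIntegral_congr_fun (measurableSet_Ioi.prod measurableSet_Ioo) hcongr]
  rw [IntegrableOn, Measure.volume_eq_prod, ← Measure.prod_restrict] at hint
  rw [Measure.volume_eq_prod, ← Measure.prod_restrict, integral_prod_symm _ hint]

/-- The part of the bisector of `p` and `q` that lies in the cell of `p`, parametrised by
the direction from `p`. -/
def edgeDirs (p q : ℂ) (T : Finset ℂ) : Set ℝ :=
  {θ | 0 < bisectorCurv p q θ ∧ ∀ q' ∈ T, bisectorCurv p q' θ ≤ bisectorCurv p q θ}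

theorem measurableSet_edgeDirs (p q : ℂ) (T : Finset ℂ) : MeasurableSet (edgeDirs p q T) := by
  have : edgeDirs p q T = {θ | 0 < bisectorCurv p q θ} ∩
      ⋂ q' ∈ T, {θ | bisectorCurv p q' θ ≤ bisectorCurv p q θ} := by
    ext θ
    simp [edgeDirs]
  rw [this]
  refine (isOpen_lt continuous_const (continuous_bisectorCurv p q)).measurableSet.inter ?_
  exact Finset.measurableSet_biInter _ fun q' _ =>
    (isClosed_le (continuous_bisectorCurv p q') (continuous_bisectorCurv p q)).measurableSet

/-- The integral of `φ` along an edge against the angle seen from `p`. -/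
noncomputable def edgeIntegral (φ : ℂ → ℝ) (p q : ℂ) (T : Finset ℂ) : ℝ :=
  ∫ θ in Ioo (-Real.pi) Real.pi ∩ edgeDirs p q T,
    φ (p + ((bisectorCurv p q θ)⁻¹ : ℝ) * unitDir θ)

theorem measurable_comp_edge {φ : ℂ → ℝ} (hφ : Continuous φ) (p q : ℂ) :
    Measurable fun θ => φ (p + ((bisectorCurv p q θ)⁻¹ : ℝ) * unitDir θ) := by
  have h1 := (continuous_bisectorCurv p q).measurable
  have h2 := continuous_unitDir.measurable
  exact hφ.measurable.comp
    (measurable_const.add ((Complex.measurable_ofReal.comp h1.inv).mul h2))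

theorem integrableOn_comp_edge {φ : ℂ → ℝ} (hφ : Continuous φ) (hs : HasCompactSupport φ)
    (p q : ℂ) (s : Set ℝ) :
    IntegrableOn (fun θ => φ (p + ((bisectorCurv p q θ)⁻¹ : ℝ) * unitDir θ))
      (Ioo (-Real.pi) Real.pi ∩ s) := by
  obtain ⟨C, hC⟩ := hs.exists_bound_of_continuous hφ
  have hfin : IsFiniteMeasure (volume.restrict (Ioo (-Real.pi) Real.pi ∩ s)) := by
    refine ⟨?_⟩
    rw [Measure.restrict_apply_univ]
    exact (measure_mono inter_subset_left).trans_lt measure_Ioo_lt_top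
  exact Integrable.of_bound (measurable_comp_edge hφ p q).aestronglyMeasurable C
    (ae_of_all _ fun θ => hC _)

theorem setIntegral_nearCell_gradLogPairing {φ : ℂ → ℝ} (hφ : ContDiff ℝ 1 φ)
    (hs : HasCompactSupport φ) {p : ℂ} {T : Finset ℂ} (hp : p ∉ T) :
    ∫ z in nearCell p T, gradLogPairing φ p z =
      -(2 * Real.pi * φ p) + ∑ q ∈ T, edgeIntegral φ p q T := by
  classical
  rw [setIntegral_gradLogPairing hφ hs p (isClosed_nearCell p T).measurableSet]
  have hae : ∀ᵐ θ ∂volume.restrict (Ioo (-Real.pi) Real.pi), ∫ r in Ioi 0,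
      ((fun x : ℝ × ℝ => p + x.1 * unitDir x.2) ⁻¹' nearCell p T).indicator
        (radialDeriv φ p) (r, θ) =
      -φ p + ∑ q ∈ T, (edgeDirs p q T).indicator
        (fun θ => φ (p + ((bisectorCurv p q θ)⁻¹ : ℝ) * unitDir θ)) θ := by
    filter_upwards [ae_restrict_of_ae (ae_injOn_bisectorCurv p T)] with θ hθ
    have hderiv : deriv (fun r : ℝ => φ (p + r * unitDir θ)) =
        fun r => radialDeriv φ p (r, θ) := by
      ext r
      exact (hasDerivAt_comp_ray hφ p r θ).deriv
    have h := integral_Ioi_indicator_deriv (contDiff_comp_ray hφ p θ)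
      (hasCompactSupport_comp_ray hs p θ) T _ hθ
    rw [hderiv] at h
    convert h using 3 with r q hq
    · simp only [indicator, mem_preimage, add_mul_unitDir_mem_nearCell_iff hp, mem_ofPred_eq]
    · simp
    · rw [indicator_apply]
      exact if_congr Iff.rfl rfl rfl
  rw [integral_congr_ae hae, integral_add (integrable_const _)]
  · rw [setIntegral_const, integral_finsetSum]
    · congr 1
      · rw [measureReal_def, Real.volume_Ioo,
          ENNReal.toReal_ofReal (by linarith [Real.pi_pos]), smul_eq_mul]
        ring
      · refine Finset.sum_congr rfl fun q _ => ?_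
        rw [setIntegral_indicator (measurableSet_edgeDirs p q T), edgeIntegral]
    · intro q _
      have := integrableOn_comp_edge hφ.continuous hs p q univ
      rw [inter_univ] at this
      exact this.indicator (measurableSet_edgeDirs p q T)
  · refine integrable_finsetSum _ fun q _ => ?_
    have := integrableOn_comp_edge hφ.continuous hs p q univ
    rw [inter_univ] at this
    exact this.indicator (measurableSet_edgeDirs p q T)

theorem integral_gradLogPairing {φ : ℂ → ℝ} (hφ : ContDiff ℝ 1 φ) (hs : HasCompactSupport φ)
    (w : ℂ) : ∫ z, gradLogPairing φ w z = -(2 * Real.pi * φ w) := by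
  have h := setIntegral_nearCell_gradLogPairing hφ hs (Finset.notMem_empty w)
  have huniv : nearCell w ∅ = univ := by
    ext z
    simp [nearCell]
  rwa [huniv, setIntegral_univ, Finset.sum_empty, add_zero] at h

/-- The arc length parametrisation of the bisector of `p` and `q`. -/
noncomputable def bisectorParam (p q : ℂ) (t : ℝ) : ℂ := p + (q - p) * (1 / 2 + I * (t / dist p q))

/-- The direction from `p` to the point of the bisector with parameter `t`. -/
noncomputable def bisectorArg (p q : ℂ) (t : ℝ) : ℝ := arg (bisectorParam p q t - p)

theorem isometry_bisectorParam {p q : ℂ} (hpq : q ≠ p) : Isometry (bisectorParam p q) := by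
  refine Isometry.of_dist_eq fun s t => ?_
  have hd : dist p q ≠ 0 := (dist_pos.2 hpq.symm).ne'
  rw [dist_eq_norm, bisectorParam, bisectorParam, show p + (q - p) * (1 / 2 + I * (s / dist p q)) -
    (p + (q - p) * (1 / 2 + I * (t / dist p q))) =
      (q - p) * I * (((s - t) / dist p q : ℝ) : ℂ) by push_cast; ring, norm_mul, norm_mul, norm_I,
    norm_real, norm_div, Real.norm_of_nonneg (dist_nonneg (x := p) (y := q)), ← dist_eq_norm q p,
    dist_comm q p, dist_eq_norm s t]
  field_simp

theorem dist_bisectorParam_left (p q : ℂ) (t : ℝ) :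
    dist (bisectorParam p q t) p = dist p q * ‖(1 / 2 : ℂ) + I * (t / dist p q)‖ := by
  rw [bisectorParam, dist_self_add_left, norm_mul, ← dist_eq_norm, dist_comm q p]

theorem dist_bisectorParam_right (p q : ℂ) (t : ℝ) :
    dist (bisectorParam p q t) q = dist (bisectorParam p q t) p := by
  rw [dist_bisectorParam_left, bisectorParam, dist_eq_norm,
    show p + (q - p) * (1 / 2 + I * (t / dist p q)) - q =
      -((q - p) * starRingEnd ℂ (1 / 2 + I * (t / dist p q))) by
        simp [map_ofNat]
        ring,
    norm_neg, norm_mul, ← dist_eq_norm, dist_comm q p, norm_conj]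

theorem mem_range_bisectorParam {p q z : ℂ} (hpq : q ≠ p) (h : dist z p = dist z q) :
    z ∈ range (bisectorParam p q) := by
  have hd : q - p ≠ 0 := sub_ne_zero.2 hpq
  have hdist : (dist p q : ℂ) ≠ 0 := ofReal_ne_zero.2 (dist_pos.2 hpq.symm).ne'
  set w := (z - p) / (q - p) with hw
  have hz : z = p + (q - p) * w := by
    rw [hw]
    field_simp
    ring
  have h1 : ‖w‖ = ‖w - 1‖ := by
    have : w - 1 = (z - q) / (q - p) := by
      rw [hw]
      field_simp
      ring
    rw [this, hw, norm_div, norm_div, ← dist_eq_norm, ← dist_eq_norm z q, h]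
  have hre : w.re = 1 / 2 := by
    have h2 := congrArg (· ^ 2) h1
    simp only [← Complex.normSq_eq_norm_sq, normSq_apply, sub_re, sub_im, one_re, one_im] at h2
    linarith
  refine ⟨dist p q * w.im, ?_⟩
  rw [bisectorParam, hz]
  congr 2
  apply Complex.ext
  · rw [ofReal_mul, mul_div_cancel_left₀ _ hdist]
    simp [hre]
  · rw [ofReal_mul, mul_div_cancel_left₀ _ hdist]
    simp

theorem bisectorParam_ne_left {p q : ℂ} (hpq : q ≠ p) (t : ℝ) : bisectorParam p q t ≠ p := by
  intro h
  have := dist_bisectorParam_right p q t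
  rw [h, dist_self] at this
  exact hpq (dist_eq_zero.1 this).symm

theorem norm_mul_unitDir_arg (z : ℂ) : (‖z‖ : ℂ) * unitDir (arg z) = z := by
  rw [unitDir, ofReal_cos, ofReal_sin, Complex.norm_mul_cos_add_sin_mul_I]

theorem norm_mul_bisectorCurv_eq_one {p q : ℂ} (hpq : q ≠ p) {r θ : ℝ}
    (h : dist (p + r * unitDir θ) p = dist (p + r * unitDir θ) q) :
    r * bisectorCurv p q θ = 1 := by
  have h1 := dist_add_mul_unitDir_sub hpq r θ
  have h2 : dist p q ^ 2 ≠ 0 := pow_ne_zero _ (dist_pos.2 hpq.symm).ne'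
  rw [h, sub_self, eq_comm, mul_eq_zero, or_iff_right h2] at h1
  linarith

theorem bisectorParam_eq_polar (p q : ℂ) (t : ℝ) :
    p + (‖bisectorParam p q t - p‖ : ℝ) * unitDir (bisectorArg p q t) = bisectorParam p q t := by
  rw [bisectorArg, norm_mul_unitDir_arg, add_sub_cancel]

theorem norm_mul_bisectorCurv_bisectorArg {p q : ℂ} (hpq : q ≠ p) (t : ℝ) :
    ‖bisectorParam p q t - p‖ * bisectorCurv p q (bisectorArg p q t) = 1 := by
  refine norm_mul_bisectorCurv_eq_one hpq ?_
  rw [bisectorParam_eq_polar, dist_bisectorParam_right]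

theorem bisectorParam_eq {p q : ℂ} (hpq : q ≠ p) (t : ℝ) :
    p + ((bisectorCurv p q (bisectorArg p q t))⁻¹ : ℝ) * unitDir (bisectorArg p q t) =
      bisectorParam p q t := by
  rw [← eq_inv_of_mul_eq_one_left (norm_mul_bisectorCurv_bisectorArg hpq t),
    bisectorParam_eq_polar]

theorem injective_bisectorArg {p q : ℂ} (hpq : q ≠ p) : Function.Injective (bisectorArg p q) := by
  intro s t h
  apply (isometry_bisectorParam hpq).injective
  rw [← bisectorParam_eq hpq s, ← bisectorParam_eq hpq t, h]

theorem bisectorCurv_bisectorArg_pos {p q : ℂ} (hpq : q ≠ p) (t : ℝ) :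
    0 < bisectorCurv p q (bisectorArg p q t) := by
  have h := norm_mul_bisectorCurv_bisectorArg hpq t
  exact pos_of_mul_pos_right (h ▸ one_pos) (norm_nonneg _)

theorem arg_mul_unitDir {r θ : ℝ} (hr : 0 < r) (hθ : θ ∈ Ioo (-Real.pi) Real.pi) :
    arg (r * unitDir θ) = θ := by
  rw [unitDir, ofReal_cos, ofReal_sin,
    Complex.arg_mul_cos_add_sin_mul_I hr (Ioo_subset_Ioc_self hθ)]

theorem hasDerivAt_bisectorArg {p q : ℂ} (hpq : q ≠ p) {t : ℝ}
    (ht : bisectorParam p q t - p ∈ slitPlane) :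
    HasDerivAt (bisectorArg p q) (dist p q /
      (2 * dist (bisectorParam p q t) p * dist (bisectorParam p q t) q)) t := by
  have hd : q - p ≠ 0 := sub_ne_zero.2 hpq
  have hdist : 0 < dist p q := dist_pos.2 hpq.symm
  have h1 : HasDerivAt (fun t : ℝ => bisectorParam p q t - p) ((q - p) * (I * (1 / dist p q))) t := by
    have := (((((hasDerivAt_id t).ofReal_comp).div_const (dist p q : ℂ)).const_mul I).const_add
      (1 / 2 : ℂ)).const_mul (q - p)
    simpa [bisectorParam] using this
  have h2 := imCLM.hasFDerivAt.comp_hasDerivAt t (h1.clog_real ht)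
  have h3 : bisectorArg p q = ⇑imCLM ∘ fun t => log (bisectorParam p q t - p) := by
    ext t
    simp [bisectorArg, log_im]
  rw [h3]
  refine h2.congr_deriv ?_
  set s := (1 / 2 : ℂ) + I * (t / dist p q) with hs
  have hsre : s.re = 1 / 2 := by
    rw [hs, ← ofReal_div]
    simp
  have hs0 : s ≠ 0 := by
    intro h
    rw [h] at hsre
    norm_num at hsre
  have hsn : ‖s‖ ≠ 0 := norm_ne_zero_iff.2 hs0
  have h4 : bisectorParam p q t - p = (q - p) * s := by rw [bisectorParam, add_sub_cancel_left]
  rw [dist_bisectorParam_right, dist_bisectorParam_left, ← hs, h4, imCLM_apply,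
    mul_div_mul_left _ _ hd, show I * (1 / (dist p q : ℂ)) / s = ((dist p q)⁻¹ : ℝ) * (I * s⁻¹) by
      push_cast
      field_simp, im_ofReal_mul, I_mul_im, inv_re, hsre, Complex.normSq_eq_norm_sq]
  field_simp

theorem edgeIntegral_eq_hausdorff (φ : ℂ → ℝ) {p q : ℂ} {T : Finset ℂ} (hp : p ∉ T) (hq : q ∈ T) :
    edgeIntegral φ p q T = ∫ z in {z | dist z p = dist z q ∧ z ∈ nearCell p T},
      φ z * (dist p q / (2 * dist z p * dist z q)) ∂μH[1] := by
  have hpq : q ≠ p := fun h => hp (h ▸ hq)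
  set E := {z | dist z p = dist z q ∧ z ∈ nearCell p T} with hE
  have hEm : MeasurableSet E :=
    (isClosed_eq (by fun_prop) (by fun_prop)).measurableSet.inter
      (isClosed_nearCell p T).measurableSet
  have hiso := isometry_bisectorParam hpq
  have hγc : Continuous (bisectorParam p q) := hiso.continuous
  have hEr : E ⊆ range (bisectorParam p q) := fun z hz => mem_range_bisectorParam hpq hz.1
  set slit := {t : ℝ | bisectorParam p q t - p ∈ slitPlane} with hslit
  have hslitm : MeasurableSet slit :=
    (isOpen_slitPlane.preimage (hγc.sub continuous_const)).measurableSet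
  have hae : (bisectorParam p q ⁻¹' E ∩ slit : Set ℝ) =ᵐ[volume] bisectorParam p q ⁻¹' E := by
    have hsub : slitᶜ.Subsingleton := by
      intro s hs t ht
      apply injective_bisectorArg hpq
      have key : ∀ t ∈ slitᶜ, bisectorArg p q t = Real.pi := by
        intro t ht
        have h1 : bisectorParam p q t - p ∉ slitPlane := ht
        rw [mem_slitPlane_iff_arg, not_and_or, not_not, not_not] at h1
        exact h1.resolve_right (sub_ne_zero.2 (bisectorParam_ne_left hpq t))
      rw [key s hs, key t ht]
    have : ∀ᵐ t : ℝ, t ∈ slit := hsub.measure_zero volume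
    exact inter_ae_eq_left_of_ae_eq_univ (eventuallyEq_univ.2 this)
  have himage : bisectorArg p q '' (bisectorParam p q ⁻¹' E ∩ slit) =
      Ioo (-Real.pi) Real.pi ∩ edgeDirs p q T := by
    ext θ
    constructor
    · rintro ⟨t, ⟨ht, hts⟩, rfl⟩
      have hts : bisectorParam p q t - p ∈ slitPlane := hts
      rw [mem_slitPlane_iff_arg] at hts
      refine ⟨⟨neg_pi_lt_arg _, lt_of_le_of_ne (arg_le_pi _) hts.1⟩,
        bisectorCurv_bisectorArg_pos hpq t, fun q' hq' => ?_⟩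
      have h1 : bisectorParam p q t ∈ nearCell p T := ht.2
      rw [← bisectorParam_eq_polar, add_mul_unitDir_mem_nearCell_iff hp] at h1
      have h2 := h1 q' hq'
      rw [← norm_mul_bisectorCurv_bisectorArg hpq t] at h2
      exact le_of_mul_le_mul_left h2 (norm_pos_iff.2 (sub_ne_zero.2 (bisectorParam_ne_left hpq t)))
    · rintro ⟨hθ, hc, hmax⟩
      set c := bisectorCurv p q θ with hcdef
      have hd := dist_add_mul_unitDir_sub hpq c⁻¹ θ
      rw [← hcdef, inv_mul_cancel₀ hc.ne', sub_self, mul_zero, sub_eq_zero,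
        sq_eq_sq₀ dist_nonneg dist_nonneg] at hd
      obtain ⟨t, ht⟩ := mem_range_bisectorParam hpq hd.symm
      have harg : bisectorArg p q t = θ := by
        rw [bisectorArg, ht, add_sub_cancel_left, arg_mul_unitDir (inv_pos.2 hc) hθ]
      refine ⟨t, ⟨⟨(dist_bisectorParam_right p q t).symm, ?_⟩, ?_⟩, harg⟩
      · rw [ht, add_mul_unitDir_mem_nearCell_iff hp]
        intro q' hq'
        calc c⁻¹ * bisectorCurv p q' θ ≤ c⁻¹ * c :=
              mul_le_mul_of_nonneg_left (hmax q' hq') (inv_nonneg.2 hc.le)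
          _ = 1 := inv_mul_cancel₀ hc.ne'
      · rw [hslit, mem_ofPred_eq, mem_slitPlane_iff_arg]
        refine ⟨?_, sub_ne_zero.2 (bisectorParam_ne_left hpq t)⟩
        change bisectorArg p q t ≠ Real.pi
        rw [harg]
        exact hθ.2.ne
  have hmap : (μH[1] : Measure ℂ).restrict E =
      (Measure.map (bisectorParam p q) volume).restrict E := by
    rw [← hausdorffMeasure_real, hiso.map_hausdorffMeasure (Or.inl zero_le_one),
      Measure.restrict_restrict_of_subset hEr]
  rw [hmap, hiso.isClosedEmbedding.measurableEmbedding.setIntegral_map, ← setIntegral_congr_set hae,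
    edgeIntegral, ← himage, integral_image_eq_integral_abs_deriv_smul
      ((hγc.measurable hEm).inter hslitm)
      (fun t ht => (hasDerivAt_bisectorArg hpq ht.2).hasDerivWithinAt)
      (injective_bisectorArg hpq).injOn]
  refine setIntegral_congr_fun ((hγc.measurable hEm).inter hslitm) fun t _ => ?_
  simp only [bisectorParam_eq hpq, smul_eq_mul]
  rw [abs_of_nonneg (by positivity), mul_comm]

theorem setLIntegral_ball_enorm_inv_le (w : ℂ) (r : ℝ) :
    ∫⁻ z in ball w r, ‖(z - w)⁻¹‖ₑ ≤ ENNReal.ofReal (2 * Real.pi * r) := by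
  rw [← lintegral_indicator measurableSet_ball, ← lintegral_add_left_eq_self _ w,
    ← Complex.lintegral_comp_polarCoord_symm, polarCoord_target]
  have hm : MeasurableSet (Ioo 0 r ×ˢ Ioo (-Real.pi) Real.pi) :=
    measurableSet_Ioo.prod measurableSet_Ioo
  calc _ ≤ ∫⁻ x in Ioi (0 : ℝ) ×ˢ Ioo (-Real.pi) Real.pi,
        (Ioo 0 r ×ˢ Ioo (-Real.pi) Real.pi).indicator 1 x := by
        refine setLIntegral_mono' (measurableSet_Ioi.prod measurableSet_Ioo) ?_
        rintro ⟨ρ, θ⟩ ⟨hρ, hθ⟩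
        have hρ : 0 < ρ := hρ
        have hsymm : Complex.polarCoord.symm (ρ, θ) = ρ * unitDir θ :=
          Complex.polarCoord_symm_apply _
        have hnorm : ‖(ρ : ℂ) * unitDir θ‖ = ρ := by
          rw [norm_mul, norm_unitDir, mul_one, norm_real, Real.norm_of_nonneg hρ.le]
        by_cases h : ρ < r
        · rw [indicator_of_mem (show (ρ, θ) ∈ Ioo 0 r ×ˢ Ioo (-Real.pi) Real.pi from
            ⟨⟨hρ, h⟩, hθ⟩), hsymm, indicator_of_mem (by rwa [mem_ball, dist_self_add_left, hnorm]),
            add_sub_cancel_left, ← ofReal_norm, norm_inv, hnorm, smul_eq_mul,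
            ← ENNReal.ofReal_mul hρ.le, mul_inv_cancel₀ hρ.ne', ENNReal.ofReal_one, Pi.one_apply]
        · rw [hsymm, indicator_of_notMem (by rwa [mem_ball, dist_self_add_left, hnorm]), smul_zero]
          exact zero_le
    _ ≤ ∫⁻ x, (Ioo 0 r ×ˢ Ioo (-Real.pi) Real.pi).indicator 1 x := setLIntegral_le_lintegral _ _
    _ = ENNReal.ofReal (2 * Real.pi * r) := by
        rw [lintegral_indicator_one hm, Measure.volume_eq_prod, Measure.prod_prod, Real.volume_Ioo,
          Real.volume_Ioo, mul_comm, ← ENNReal.ofReal_mul (by linarith [Real.pi_pos])]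
        congr 1
        ring

theorem setLIntegral_enorm_inv_le (w : ℂ) {r : ℝ} (hr : 0 < r) (E : Set ℂ) :
    ∫⁻ z in E, ‖(z - w)⁻¹‖ₑ ≤
      ENNReal.ofReal (2 * Real.pi * r) + ENNReal.ofReal r⁻¹ * volume E := by
  calc ∫⁻ z in E, ‖(z - w)⁻¹‖ₑ
      ≤ ∫⁻ z in E, ((ball w r).indicator (fun z => ‖(z - w)⁻¹‖ₑ) z + ENNReal.ofReal r⁻¹) := by
        refine lintegral_mono fun z => ?_
        by_cases h : z ∈ ball w r
        · rw [indicator_of_mem h]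
          exact le_self_add
        · rw [indicator_of_notMem h, zero_add, ← ofReal_norm, norm_inv]
          rw [mem_ball, not_lt, dist_eq_norm] at h
          exact ENNReal.ofReal_le_ofReal (inv_anti₀ hr h)
    _ = (∫⁻ z in E, (ball w r).indicator (fun z => ‖(z - w)⁻¹‖ₑ) z) +
          ENNReal.ofReal r⁻¹ * volume E := by
        rw [lintegral_add_right _ measurable_const, setLIntegral_const]
    _ ≤ _ := by
        gcongr
        refine (setLIntegral_le_lintegral _ _).trans ?_
        rw [lintegral_indicator measurableSet_ball]
        exact setLIntegral_ball_enorm_inv_le w r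

theorem exists_norm_fderiv_le {φ : ℂ → ℝ} (hφ : ContDiff ℝ 1 φ) (hs : HasCompactSupport φ) :
    ∃ M, 0 ≤ M ∧ ∀ z, ‖fderiv ℝ φ z‖ ≤ M := by
  obtain ⟨M, hM⟩ := (hs.fderiv ℝ).exists_bound_of_continuous (hφ.continuous_fderiv one_ne_zero)
  exact ⟨M, (norm_nonneg _).trans (hM 0), hM⟩

theorem enorm_gradLogPairing_le {φ : ℂ → ℝ} {M : ℝ} (hM : ∀ z, ‖fderiv ℝ φ z‖ ≤ M) (w z : ℂ) :
    ‖gradLogPairing φ w z‖ₑ ≤ ENNReal.ofReal M * ‖(z - w)⁻¹‖ₑ := by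
  have hM0 : 0 ≤ M := (norm_nonneg _).trans (hM 0)
  rw [← ofReal_norm, ← ofReal_norm, ← ENNReal.ofReal_mul hM0]
  refine ENNReal.ofReal_le_ofReal ?_
  have := (fderiv ℝ φ z).le_of_opNorm_le (hM z) (starRingEnd ℂ (z - w))⁻¹
  rwa [norm_inv, norm_conj, ← norm_inv] at this

theorem measurable_gradLogPairing {φ : ℂ → ℝ} (w : ℂ) :
    Measurable (gradLogPairing φ w) := by
  have h : gradLogPairing φ w = fun z => ((z - w)⁻¹).re * fderiv ℝ φ z 1 -
      ((z - w)⁻¹).im * fderiv ℝ φ z I := by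
    ext z
    have : (starRingEnd ℂ (z - w))⁻¹ = ((z - w)⁻¹).re • (1 : ℂ) - ((z - w)⁻¹).im • I := by
      rw [← map_inv₀]
      generalize (z - w)⁻¹ = v
      apply Complex.ext <;> simp
    rw [gradLogPairing, this, map_sub, map_smul, map_smul, smul_eq_mul, smul_eq_mul]
  rw [h]
  have h1 := measurable_fderiv_apply_const ℝ φ 1
  have h2 := measurable_fderiv_apply_const ℝ φ I
  have h3 : Measurable fun z : ℂ => (z - w)⁻¹ := (measurable_id.sub_const w).inv
  exact ((measurable_re.comp h3).mul h1).sub ((measurable_im.comp h3).mul h2)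

theorem support_gradLogPairing_subset (φ : ℂ → ℝ) (w : ℂ) :
    Function.support (gradLogPairing φ w) ⊆ tsupport φ := by
  intro z hz
  by_contra h
  refine hz ?_
  rw [gradLogPairing, image_eq_zero_of_notMem_tsupport
    (fun h' => h (tsupport_fderiv_subset ℝ h')), zero_apply]

theorem integrable_gradLogPairing {φ : ℂ → ℝ} (hφ : ContDiff ℝ 1 φ) (hs : HasCompactSupport φ)
    (w : ℂ) : Integrable (gradLogPairing φ w) := by
  rw [← integrableOn_iff_integrable_of_support_subset (support_gradLogPairing_subset φ w)]
  obtain ⟨M, -, hM⟩ := exists_norm_fderiv_le hφ hs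
  refine ⟨(measurable_gradLogPairing w).aestronglyMeasurable, ?_⟩
  calc _ ≤ ∫⁻ z in tsupport φ, ENNReal.ofReal M * ‖(z - w)⁻¹‖ₑ :=
        lintegral_mono (enorm_gradLogPairing_le hM w)
    _ = ENNReal.ofReal M * ∫⁻ z in tsupport φ, ‖(z - w)⁻¹‖ₑ :=
        lintegral_const_mul' _ _ ENNReal.ofReal_ne_top
    _ < ⊤ := by
        refine ENNReal.mul_lt_top ENNReal.ofReal_lt_top
          ((setLIntegral_enorm_inv_le w one_pos _).trans_lt ?_)
        exact ENNReal.add_lt_top.2 ⟨ENNReal.ofReal_lt_top,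
          ENNReal.mul_lt_top ENNReal.ofReal_lt_top hs.isCompact.measure_lt_top⟩

theorem integrable_multiset_sum_gradLogPairing {φ : ℂ → ℝ} (hφ : ContDiff ℝ 1 φ)
    (hs : HasCompactSupport φ) (R : Multiset ℂ) :
    Integrable fun z => (R.map fun w => gradLogPairing φ w z).sum := by
  induction R using Multiset.induction_on with
  | empty => simp
  | cons w R ih =>
    simp only [Multiset.map_cons, Multiset.sum_cons]
    exact (integrable_gradLogPairing hφ hs w).add ih

theorem integral_multiset_sum_gradLogPairing {φ : ℂ → ℝ} (hφ : ContDiff ℝ 1 φ)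
    (hs : HasCompactSupport φ) (R : Multiset ℂ) :
    ∫ z, (R.map fun w => gradLogPairing φ w z).sum = -(2 * Real.pi * (R.map φ).sum) := by
  induction R using Multiset.induction_on with
  | empty => simp
  | cons w R ih =>
    simp only [Multiset.map_cons, Multiset.sum_cons]
    rw [integral_add (integrable_gradLogPairing hφ hs w)
      (integrable_multiset_sum_gradLogPairing hφ hs R), ih, integral_gradLogPairing hφ hs]
    ring

theorem setLIntegral_multiset_sum_gradLogPairing_le {φ : ℂ → ℝ} {M r : ℝ}
    (hM : ∀ z, ‖fderiv ℝ φ z‖ ≤ M) (hr : 0 < r) (E : Set ℂ) (R : Multiset ℂ) :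
    ∫⁻ z in E, ‖(R.map fun w => gradLogPairing φ w z).sum‖ₑ ≤ R.card * (ENNReal.ofReal M *
      (ENNReal.ofReal (2 * Real.pi * r) + ENNReal.ofReal r⁻¹ * volume E)) := by
  induction R using Multiset.induction_on with
  | empty => simp
  | cons w R ih =>
    simp only [Multiset.map_cons, Multiset.sum_cons, Multiset.card_cons]
    calc _ ≤ ∫⁻ z in E, (‖gradLogPairing φ w z‖ₑ +
          ‖(R.map fun w => gradLogPairing φ w z).sum‖ₑ) := lintegral_mono fun z => enorm_add_le _ _
      _ = (∫⁻ z in E, ‖gradLogPairing φ w z‖ₑ) +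
          ∫⁻ z in E, ‖(R.map fun w => gradLogPairing φ w z).sum‖ₑ :=
          lintegral_add_left (measurable_gradLogPairing w).enorm _
      _ ≤ _ := by
          rw [Nat.cast_add, Nat.cast_one, add_mul, one_mul, add_comm]
          gcongr
          calc _ ≤ ∫⁻ z in E, ENNReal.ofReal M * ‖(z - w)⁻¹‖ₑ :=
                lintegral_mono (enorm_gradLogPairing_le hM w)
            _ = ENNReal.ofReal M * ∫⁻ z in E, ‖(z - w)⁻¹‖ₑ :=
                lintegral_const_mul' _ _ ENNReal.ofReal_ne_top
            _ ≤ _ := by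
                gcongr
                exact setLIntegral_enorm_inv_le w hr E

theorem unifIntegrable_multiset_sum_gradLogPairing {φ : ℂ → ℝ} (hφ : ContDiff ℝ 1 φ)
    (hs : HasCompactSupport φ) {R : ℕ → Multiset ℂ} {C : ℝ} (hR : ∀ n, ((R n).card : ℝ) / n ≤ C)
    (K : Set ℂ) :
    UnifIntegrable (fun (n : ℕ) z => ((R n).map fun w => gradLogPairing φ w z).sum / n) 1
      (volume.restrict K) := by
  obtain ⟨M, hM0, hM⟩ := exists_norm_fderiv_le hφ hs
  have hC : 0 ≤ C := le_trans (by positivity) (hR 0)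
  intro ε hε
  set B := C * M + 1 with hB
  have hB0 : 0 < B := by positivity
  set r := ε / (4 * Real.pi * B) with hr
  have hr0 : 0 < r := by positivity
  refine ⟨r * ε / (2 * B), by positivity, fun n s hms hμ => ?_⟩
  rw [eLpNorm_indicator_eq_eLpNorm_restrict hms, eLpNorm_one_eq_lintegral_enorm,
    Measure.restrict_restrict hms]
  rw [Measure.restrict_apply hms] at hμ
  have hn : ‖((n : ℝ))⁻¹‖ₑ = ENNReal.ofReal (n : ℝ)⁻¹ := by
    rw [← ofReal_norm, Real.norm_of_nonneg (by positivity)]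
  calc _ = ENNReal.ofReal (n : ℝ)⁻¹ *
        ∫⁻ z in s ∩ K, ‖((R n).map fun w => gradLogPairing φ w z).sum‖ₑ := by
        rw [← lintegral_const_mul' _ _ ENNReal.ofReal_ne_top]
        refine lintegral_congr fun z => ?_
        beta_reduce
        rw [div_eq_inv_mul, enorm_mul, hn]
    _ ≤ ENNReal.ofReal (n : ℝ)⁻¹ * ((R n).card * (ENNReal.ofReal M *
      (ENNReal.ofReal (2 * Real.pi * r) + ENNReal.ofReal r⁻¹ *
        ENNReal.ofReal (r * ε / (2 * B))))) := by
        gcongr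
        refine (setLIntegral_multiset_sum_gradLogPairing_le hM hr0 _ _).trans ?_
        gcongr
    _ = ENNReal.ofReal ((n : ℝ)⁻¹ * ((R n).card * (M *
        (2 * Real.pi * r + r⁻¹ * (r * ε / (2 * B)))))) := by
        rw [← ENNReal.ofReal_natCast, ← ENNReal.ofReal_mul (by positivity),
          ← ENNReal.ofReal_add (by positivity) (by positivity), ← ENNReal.ofReal_mul hM0,
          ← ENNReal.ofReal_mul (by positivity), ← ENNReal.ofReal_mul (by positivity)]
    _ ≤ ENNReal.ofReal ε := by
        refine ENNReal.ofReal_le_ofReal ?_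
        have h1 : 2 * Real.pi * r + r⁻¹ * (r * ε / (2 * B)) = ε / B := by
          rw [hr]
          field_simp
          ring
        calc _ = ((R n).card / n : ℝ) * M * (ε / B) := by
              rw [h1]
              ring
          _ ≤ C * M * (ε / B) := by
              gcongr
              exact hR n
          _ ≤ B * (ε / B) := by
              gcongr
              linarith
          _ = ε := by field_simp

theorem ae_dist_ne_dist (S : Finset ℂ) :
    ∀ᵐ z : ℂ, z ∉ S ∧ ∀ p ∈ S, ∀ q ∈ S, p ≠ q → dist z p ≠ dist z q := by
  have h1 : ∀ᵐ z : ℂ, z ∉ S := by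
    simpa using S.finite_toSet.countable.ae_notMem volume
  have h2 : ∀ᵐ z : ℂ, ∀ p ∈ S, ∀ q ∈ S, p ≠ q → dist z p ≠ dist z q := by
    refine (ae_ball_iff S.countable_toSet).2 fun p _ =>
      (ae_ball_iff S.countable_toSet).2 fun q _ => ?_
    refine Filter.eventually_imp_distrib_left.2 fun hpq => ?_
    have h3 := Measure.addHaar_affineSubspace volume (AffineSubspace.perpBisector p q)
      (fun h => hpq (AffineSubspace.perpBisector_eq_top.1 h))
    refine measure_mono_null (fun z hz => ?_) h3
    simpa [AffineSubspace.mem_perpBisector_iff_dist_eq] using hz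
  filter_upwards [h1, h2] with z hz1 hz2 using ⟨hz1, hz2⟩

theorem multiset_sum_gradLogPairing (φ : ℂ → ℝ) (R : Multiset ℂ) (z : ℂ) :
    (R.map fun w => gradLogPairing φ w z).sum =
      fderiv ℝ φ z (starRingEnd ℂ (R.map fun w => 1 / (z - w)).sum) := by
  induction R using Multiset.induction_on with
  | empty => simp
  | cons w R ih =>
    rw [Multiset.map_cons, Multiset.sum_cons, ih, Multiset.map_cons, Multiset.sum_cons, map_add,
      map_add, gradLogPairing, one_div, map_inv₀ (starRingEnd ℂ)]

theorem mem_nearCell_erase_iff {S : Finset ℂ} {p z : ℂ} :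
    z ∈ nearCell p (S.erase p) ↔ ∀ q ∈ S, dist z p ≤ dist z q := by
  refine ⟨fun h q hq => ?_, fun h q hq => h q (Finset.mem_of_mem_erase hq)⟩
  by_cases hqp : q = p
  · rw [hqp]
  · exact h q (Finset.mem_erase.2 ⟨hqp, hq⟩)

theorem card_roots_derivNumerator_div_le (P Q : Polynomial ℂ) (n : ℕ) :
    ((derivNumerator P Q n).roots.card : ℝ) / n ≤ P.natDegree + Q.roots.toFinset.card := by
  rcases Nat.eq_zero_or_pos n with rfl | hn
  · rw [Nat.cast_zero, div_zero]
    positivity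
  rw [div_le_iff₀ (Nat.cast_pos.2 hn)]
  have h := ((derivNumerator P Q n).card_roots').trans (natDegree_derivNumerator_le P Q n)
  have h' : P.natDegree + n * Q.roots.toFinset.card ≤
      (P.natDegree + Q.roots.toFinset.card) * n := by nlinarith [Nat.zero_le P.natDegree]
  exact_mod_cast h.trans h'

/-- The integral of `φ` against the Cauchy measure of the Voronoi diagram of `S`. -/
noncomputable def voronoiIntegral (φ : ℂ → ℝ) (S : Finset ℂ) : ℝ :=
  (2 * Real.pi)⁻¹ * ∑ p ∈ S, ∑ q ∈ S.erase p, edgeIntegral φ p q (S.erase p)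

theorem ae_tendsto_sum_gradLogPairing {P Q : Polynomial ℂ} (hPQ : IsCoprime P Q)
    (hQ : 1 ≤ Q.natDegree) {f : ℂ → ℂ} (hf : ∀ z : ℂ, Q.eval z ≠ 0 → f z = P.eval z / Q.eval z)
    (φ : ℂ → ℝ) :
    ∀ᵐ z : ℂ, Tendsto
      (fun n : ℕ => ((derivNumerator P Q n).roots.map fun w => gradLogPairing φ w z).sum / n) atTop
      (𝓝 (∑ p ∈ Q.roots.toFinset, (gradLogPairing φ p z -
        (nearCell p (Q.roots.toFinset.erase p)).indicator (gradLogPairing φ p) z))) := by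
  have hQ0 : Q ≠ 0 := by
    rintro rfl
    simp at hQ
  filter_upwards [ae_dist_ne_dist Q.roots.toFinset] with z ⟨hzS, hz⟩
  have hS : Q.roots.toFinset.Nonempty := by
    obtain ⟨p, hp⟩ := IsAlgClosed.exists_root Q (Polynomial.natDegree_pos_iff_degree_pos.1 hQ).ne'
    exact ⟨p, by rw [Multiset.mem_toFinset, Polynomial.mem_roots hQ0]; exact hp⟩
  obtain ⟨p, hp, hmin⟩ := Finset.exists_min_image Q.roots.toFinset (dist z) hS
  have hpr : Q.IsRoot p := by rwa [Multiset.mem_toFinset, Polynomial.mem_roots hQ0] at hp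
  have hzQ : Q.eval z ≠ 0 := by
    rwa [Multiset.mem_toFinset, Polynomial.mem_roots hQ0] at hzS
  have hlim := tendsto_logDeriv_derivNumerator hPQ hQ0 hf hpr hzQ fun q hq hqp =>
    lt_of_le_of_ne (hmin q hq) (hz p hp q hq hqp.symm)
  have hcont : Continuous fun v : ℂ => fderiv ℝ φ z (starRingEnd ℂ v) :=
    (fderiv ℝ φ z).continuous.comp continuous_conj
  have h1 := (hcont.tendsto _).comp hlim
  have hvalue : fderiv ℝ φ z (starRingEnd ℂ
      (∑ q ∈ Q.roots.toFinset, 1 / (z - q) - 1 / (z - p))) =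
      ∑ p ∈ Q.roots.toFinset, (gradLogPairing φ p z -
        (nearCell p (Q.roots.toFinset.erase p)).indicator (gradLogPairing φ p) z) := by
    rw [Finset.sum_sub_distrib, map_sub, map_sub, map_sum, map_sum,
      Finset.sum_eq_single_of_mem (f := fun p =>
        (nearCell p (Q.roots.toFinset.erase p)).indicator (gradLogPairing φ p) z) p hp,
      indicator_of_mem (mem_nearCell_erase_iff.2 hmin)]
    · simp only [gradLogPairing, one_div, map_inv₀]
    · intro q hq hqp
      refine indicator_of_notMem (fun h => ?_) _
      exact hz p hp q hq hqp.symm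
        (le_antisymm (hmin q hq) (mem_nearCell_erase_iff.1 h p hp))
  rw [hvalue] at h1
  refine h1.congr fun n => ?_
  rw [multiset_sum_gradLogPairing, Function.comp_apply, div_eq_inv_mul,
    show ((n : ℂ))⁻¹ = ((n : ℝ)⁻¹ : ℝ) by push_cast; rfl,
    map_mul, conj_ofReal, ← Complex.real_smul, map_smul, smul_eq_mul, div_eq_inv_mul]

theorem tendsto_sum_roots_of_contDiff {P Q : Polynomial ℂ} (hPQ : IsCoprime P Q)
    (hQ : 1 ≤ Q.natDegree) {f : ℂ → ℂ} (hf : ∀ z : ℂ, Q.eval z ≠ 0 → f z = P.eval z / Q.eval z)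
    {φ : ℂ → ℝ} (hφ : ContDiff ℝ 1 φ) (hs : HasCompactSupport φ) :
    Tendsto (fun n : ℕ => ((derivNumerator P Q n).roots.map φ).sum / n) atTop
      (𝓝 (voronoiIntegral φ Q.roots.toFinset)) := by
  set S := Q.roots.toFinset
  set K := tsupport φ
  have hfin : IsFiniteMeasure (volume.restrict K) :=
    ⟨by rw [Measure.restrict_apply_univ]; exact hs.isCompact.measure_lt_top⟩
  set F : ℕ → ℂ → ℝ := fun n z =>
    ((derivNumerator P Q n).roots.map fun w => gradLogPairing φ w z).sum / n with hF
  set G : ℂ → ℝ := fun z => ∑ p ∈ S, (gradLogPairing φ p z -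
        (nearCell p (S.erase p)).indicator (gradLogPairing φ p) z) with hG
  have hFint : ∀ n, Integrable (F n) := fun n =>
    (integrable_multiset_sum_gradLogPairing hφ hs _).div_const _
  have hcell : ∀ p, Integrable ((nearCell p (S.erase p)).indicator (gradLogPairing φ p)) :=
    fun p => (integrable_gradLogPairing hφ hs p).indicator (isClosed_nearCell _ _).measurableSet
  have hGint : Integrable G := integrable_finsetSum _ fun p _ =>
    (integrable_gradLogPairing hφ hs p).sub (hcell p)
  have hFK : ∀ n, ∫ z in K, F n z = -(2 * Real.pi) *
      (((derivNumerator P Q n).roots.map φ).sum / n) := by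
    intro n
    rw [setIntegral_eq_integral_of_forall_compl_eq_zero, hF, integral_div,
      integral_multiset_sum_gradLogPairing hφ hs]
    · ring
    · intro z hz
      have : ∀ w, gradLogPairing φ w z = 0 := fun w => by
        by_contra h
        exact hz (support_gradLogPairing_subset φ w h)
      simp [hF, this]
  have hGK : ∫ z in K, G z = -(2 * Real.pi) * voronoiIntegral φ S := by
    rw [setIntegral_eq_integral_of_forall_compl_eq_zero, hG, integral_finsetSum S
      (f := fun p z => gradLogPairing φ p z -
        (nearCell p (S.erase p)).indicator (gradLogPairing φ p) z) fun p _ =>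
          (integrable_gradLogPairing hφ hs p).sub (hcell p), voronoiIntegral, ← mul_assoc,
      neg_mul, mul_inv_cancel₀ (by positivity), neg_one_mul, ← Finset.sum_neg_distrib]
    · refine Finset.sum_congr rfl fun p _ => ?_
      rw [integral_sub (integrable_gradLogPairing hφ hs p) (hcell p),
        integral_indicator (isClosed_nearCell _ _).measurableSet,
        integral_gradLogPairing hφ hs,
        setIntegral_nearCell_gradLogPairing hφ hs (Finset.notMem_erase p S)]
      ring
    · intro z hz
      have : ∀ w, gradLogPairing φ w z = 0 := fun w => by
        by_contra h
        exact hz (support_gradLogPairing_subset φ w h)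
      simp [hG, indicator, this]
  have hL1 := tendsto_Lp_finite_of_tendsto_ae (μ := volume.restrict K) (p := 1) (f := F) (g := G)
    le_rfl ENNReal.one_ne_top (fun n => (hFint n).integrableOn.aestronglyMeasurable)
    (memLp_one_iff_integrable.2 hGint.integrableOn)
    (unifIntegrable_multiset_sum_gradLogPairing hφ hs (card_roots_derivNumerator_div_le P Q) K)
    (ae_restrict_of_ae (ae_tendsto_sum_gradLogPairing hPQ hQ hf φ))
  have hlim := tendsto_integral_of_L1' G hGint.integrableOn.aestronglyMeasurable
    (Eventually.of_forall fun n => (hFint n).integrableOn) hL1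
  simp only [hFK, hGK] at hlim
  have := hlim.const_mul (-(2 * Real.pi))⁻¹
  have hpi : -(2 * Real.pi) ≠ 0 := neg_ne_zero.2 (by positivity)
  simpa only [inv_mul_cancel_left₀ hpi] using this

theorem abs_edgeIntegral_sub_le {φ ψ : ℂ → ℝ} (hφ : Continuous φ) (hφs : HasCompactSupport φ)
    (hψ : Continuous ψ) (hψs : HasCompactSupport ψ) {ε : ℝ} (h : ∀ z, |ψ z - φ z| ≤ ε)
    (p q : ℂ) (T : Finset ℂ) :
    |edgeIntegral ψ p q T - edgeIntegral φ p q T| ≤ 2 * Real.pi * ε := by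
  have hε : 0 ≤ ε := (abs_nonneg _).trans (h 0)
  have hsub := measure_mono (μ := volume)
    (inter_subset_left (s := Ioo (-Real.pi) Real.pi) (t := edgeDirs p q T))
  rw [edgeIntegral, edgeIntegral, ← integral_sub (integrableOn_comp_edge hψ hψs p q _)
    (integrableOn_comp_edge hφ hφs p q _), ← Real.norm_eq_abs]
  refine (norm_setIntegral_le_of_norm_le_const (hsub.trans_lt measure_Ioo_lt_top)
    fun θ _ => h _).trans ?_
  rw [mul_comm ε]
  gcongr
  rw [measureReal_def]
  refine ENNReal.toReal_le_of_le_ofReal (by positivity) (hsub.trans ?_)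
  rw [Real.volume_Ioo]
  exact ENNReal.ofReal_le_ofReal (by linarith)

theorem abs_voronoiIntegral_sub_le {φ ψ : ℂ → ℝ} (hφ : Continuous φ) (hφs : HasCompactSupport φ)
    (hψ : Continuous ψ) (hψs : HasCompactSupport ψ) {ε : ℝ} (h : ∀ z, |ψ z - φ z| ≤ ε)
    (S : Finset ℂ) :
    |voronoiIntegral ψ S - voronoiIntegral φ S| ≤ (S.card : ℝ) ^ 2 * ε := by
  have hε : 0 ≤ ε := (abs_nonneg _).trans (h 0)
  rw [voronoiIntegral, voronoiIntegral, ← mul_sub, abs_mul, abs_of_nonneg (by positivity),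
    ← Finset.sum_sub_distrib, inv_mul_le_iff₀ (by positivity)]
  calc _ ≤ ∑ p ∈ S, (S.card : ℝ) * (2 * Real.pi * ε) := by
        refine (Finset.abs_sum_le_sum_abs _ _).trans (Finset.sum_le_sum fun p _ => ?_)
        rw [← Finset.sum_sub_distrib]
        calc _ ≤ ∑ q ∈ S.erase p, 2 * Real.pi * ε :=
              (Finset.abs_sum_le_sum_abs _ _).trans (Finset.sum_le_sum fun q _ =>
                abs_edgeIntegral_sub_le hφ hφs hψ hψs h p q _)
          _ ≤ _ := by
              rw [Finset.sum_const, nsmul_eq_mul]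
              gcongr
              exact Finset.erase_subset _ _
    _ = _ := by
        rw [Finset.sum_const, nsmul_eq_mul]
        ring

theorem abs_multiset_sum_sub_le {φ ψ : ℂ → ℝ} {ε : ℝ} (h : ∀ z, |ψ z - φ z| ≤ ε)
    (R : Multiset ℂ) : |(R.map ψ).sum - (R.map φ).sum| ≤ R.card * ε := by
  induction R using Multiset.induction_on with
  | empty => simp
  | cons w R ih =>
    simp only [Multiset.map_cons, Multiset.sum_cons, Multiset.card_cons]
    rw [add_sub_add_comm]
    push_cast
    linarith [abs_add_le (ψ w - φ w) ((R.map ψ).sum - (R.map φ).sum), h w]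

theorem tendsto_sum_roots {P Q : Polynomial ℂ} (hPQ : IsCoprime P Q)
    (hQ : 1 ≤ Q.natDegree) {f : ℂ → ℂ} (hf : ∀ z : ℂ, Q.eval z ≠ 0 → f z = P.eval z / Q.eval z)
    {φ : ℂ → ℝ} (hφ : Continuous φ) (hs : HasCompactSupport φ) :
    Tendsto (fun n : ℕ => ((derivNumerator P Q n).roots.map φ).sum / n) atTop
      (𝓝 (voronoiIntegral φ Q.roots.toFinset)) := by
  rw [Metric.tendsto_atTop]
  intro ε hε
  set C : ℝ := P.natDegree + Q.roots.toFinset.card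
  set D : ℝ := (Q.roots.toFinset.card : ℝ) ^ 2
  have hC0 : 0 ≤ C := by positivity
  set η := ε / (2 * (C + D + 1)) with hη
  have hη0 : 0 < η := by positivity
  obtain ⟨ψ, hψ, hclose, hsupp⟩ := hφ.exists_contDiff_approx (n := 1) (ε := fun _ => η)
    continuous_const fun _ => hη0
  have hψs : HasCompactSupport ψ := hs.mono hsupp
  have hle : ∀ z, |ψ z - φ z| ≤ η := fun z => by
    have := (hclose z).le
    rwa [Real.dist_eq] at this
  obtain ⟨N, hN⟩ := Metric.tendsto_atTop.1
    (tendsto_sum_roots_of_contDiff hPQ hQ hf hψ hψs) (ε / 2) (half_pos hε)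
  refine ⟨N, fun n hn => ?_⟩
  have h1 := hN n hn
  have h2 := abs_voronoiIntegral_sub_le hφ hs hψ.continuous hψs hle Q.roots.toFinset
  have h3 : |((derivNumerator P Q n).roots.map ψ).sum / n -
      ((derivNumerator P Q n).roots.map φ).sum / n| ≤ C * η := by
    rw [← sub_div, abs_div, Nat.abs_cast]
    calc _ ≤ ((derivNumerator P Q n).roots.card * η) / n := by
          gcongr
          exact abs_multiset_sum_sub_le hle _
      _ = ((derivNumerator P Q n).roots.card : ℝ) / n * η := by ring
      _ ≤ C * η := by
          gcongr
          exact card_roots_derivNumerator_div_le P Q n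
  have h4 : (C + D) * η < ε / 2 := by
    have : (C + D + 1) * η = ε / 2 := by
      have : C + D + 1 ≠ 0 := by positivity
      rw [hη]
      field_simp
    linarith
  rw [Real.dist_eq, abs_lt] at *
  rw [abs_le] at h2 h3
  constructor <;> linarith

theorem voronoiIntegral_eq (φ : ℂ → ℝ) (S : Finset ℂ) :
    voronoiIntegral φ S = (1 / 2) * ∑ p ∈ S, ∑ q ∈ S,
      if p ≠ q then
        ∫ z in {z : ℂ | dist z p = dist z q ∧ dist z p = Metric.infDist z (S : Set ℂ)},
          φ z * (dist p q / (2 * Real.pi * dist z p * dist z q)) ∂ μH[1]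
      else 0 := by
  rw [voronoiIntegral, mul_inv, ← one_div, mul_assoc, Finset.mul_sum]
  congr 1
  refine Finset.sum_congr rfl fun p hp => ?_
  rw [← Finset.sum_filter, Finset.filter_ne, Finset.mul_sum]
  refine Finset.sum_congr rfl fun q hq => ?_
  have hset : {z : ℂ | dist z p = dist z q ∧ dist z p = Metric.infDist z (S : Set ℂ)} =
      {z | dist z p = dist z q ∧ z ∈ nearCell p (S.erase p)} := by
    ext z
    refine and_congr_right fun _ => ?_
    rw [mem_nearCell_erase_iff]
    constructor
    · intro h q hq
      rw [h]
      exact infDist_le_dist_of_mem hq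
    · intro h
      refine le_antisymm ?_ (infDist_le_dist_of_mem hp)
      exact (le_infDist ⟨p, hp⟩).2 fun {q} hq => h q hq
  rw [edgeIntegral_eq_hausdorff φ (Finset.notMem_erase p S) hq, hset, ← integral_const_mul]
  refine integral_congr_ae (ae_of_all _ fun z => ?_)
  simp only [div_eq_mul_inv, mul_inv]
  ring

/-- **Measure-theoretic refinement of Pólya's shire theorem for rational functions.**
The normalized root-counting measures of the iterated derivatives of `f = P/Q`
converge weakly (against continuous compactly supported test functions on `ℂ`) to the
Cauchy measure of the Voronoi diagram of the poles of `f`: on the edge equidistant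
from the two nearest poles `p, q` it has density `|p − q|/(2π|z − p||z − q|)` with
respect to the one-dimensional Hausdorff measure. -/
theorem polya_shire_rational_measure
    (P Q : Polynomial ℂ) (hPQ : IsCoprime P Q) (hQ : 1 ≤ Q.natDegree)
    (f : ℂ → ℂ) (hf : ∀ z : ℂ, Q.eval z ≠ 0 → f z = P.eval z / Q.eval z)
    (m : ℕ → ℂ → ℕ)
    (hm : ∀ n : ℕ, ∀ w : ℂ, Q.eval w ≠ 0 → iteratedDeriv n f w = 0 →
        m n w = sInf {k : ℕ | iteratedDeriv (n + k) f w ≠ 0})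
    (φ : ℂ → ℝ) (hφc : Continuous φ) (hφs : HasCompactSupport φ) :
    Tendsto (fun n : ℕ =>
        (1 / (n : ℝ)) * ∑ᶠ w ∈ {w : ℂ | Q.eval w ≠ 0 ∧ iteratedDeriv n f w = 0},
          (m n w : ℝ) * φ w)
      atTop
      (nhds ((1 / 2) * ∑ p ∈ Q.roots.toFinset, ∑ q ∈ Q.roots.toFinset,
          if p ≠ q then
            ∫ z in {z : ℂ | dist z p = dist z q ∧
                dist z p = Metric.infDist z (Q.roots.toFinset : Set ℂ)},
              φ z * (dist p q / (2 * Real.pi * dist z p * dist z q)) ∂ μH[1]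
          else 0)) := by
  rw [← voronoiIntegral_eq φ Q.roots.toFinset]
  refine (tendsto_sum_roots hPQ hQ hf hφc hφs).congr fun n => ?_
  rw [finsum_zeros_eq_sum_roots hPQ hQ hf m hm φ n, one_div, div_eq_inv_mul]
end
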